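/- Let L be a relational first-order language and let T be a complete monomorphic L-theory having infinite models. Then I(T,ω) = 1 if and only if some countably infinite model Y of T is chained by a linear order < on its domain whose complete first-order theory is ℵ₀-categorical. -/

import Mathlib

open FirstOrder Cardinal

universe u v w w' x

/-- The substructure of an `L`-structure induced on a subset of its domain
(for a relational language every subset is the domain of an induced substructure). -/
def inducedStructure (L : FirstOrder.Language.{u, v}) [L.IsRelational] {M : Type w}
    [L.Structure M] (s : Set M) : L.Structure s where
  funMap f := isEmptyElim f
  RelMap R v := FirstOrder.Language.Structure.RelMap R (fun i => (v i : M))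

/-- A structure `M` is monomorphic if for every (positive) natural number `n`, any two
`n`-element subsets of its domain carry isomorphic induced substructures. -/
def IsMonomorphic (L : FirstOrder.Language.{u, v}) [L.IsRelational] (M : Type w)
    [L.Structure M] : Prop :=
  ∀ s t : Set M, s.Finite → t.Finite → s.ncard = t.ncard →
    Nonempty (@FirstOrder.Language.Equiv L s t (inducedStructure L s) (inducedStructure L t))

/-- A linear order on `A`, regarded as a structure for the language with a single binary
relation symbol, the symbol being interpreted as the strict order `<`. -/
def ltStructure {A : Type w} (lo : LinearOrder A) : FirstOrder.Language.order.Structure A where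
  funMap f := isEmptyElim f
  RelMap {n} r v := match n, r with
    | 2, .le => lo.lt (v 0) (v 1)

/-- A linear order on the domain of an `L`-structure `M` chains `M` (equivalently, `M` is
simply definable in the linear order) if every relation of `M` is defined by a
quantifier-free formula of the language of one binary relation symbol, realized in the
linear order. -/
def Chains (L : FirstOrder.Language.{u, v}) {M : Type w} [L.Structure M]
    (lo : LinearOrder M) : Prop :=
  ∀ (m : ℕ) (R : L.Relations m), ∃ φ : FirstOrder.Language.order.Formula (Fin m),
    φ.IsQF ∧ ∀ v : Fin m → M,
      FirstOrder.Language.Structure.RelMap R v ↔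
        @FirstOrder.Language.Formula.Realize _ _ (ltStructure lo) _ φ v

/-- The isomorphism classes of models of `T` with domain `ℕ`. -/
def CountableModelClasses (L : FirstOrder.Language.{u, v}) (T : L.Theory) : Type (max u v) :=
  Quot (fun S₁ S₂ : {S : L.Structure ℕ // @FirstOrder.Language.Theory.Model L ℕ S T} =>
    Nonempty (@FirstOrder.Language.Equiv L ℕ ℕ S₁.1 S₂.1))

/-- `I(T,ω)`: the number of isomorphism classes of models of `T` with domain `ℕ`
(equivalently, of countably infinite models of `T`, when `T` has only infinite models). -/
noncomputable def numCountableModels (L : FirstOrder.Language.{u, v}) (T : L.Theory) :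
    Cardinal.{max u v} :=
  Cardinal.mk (CountableModelClasses L T)

/-- A theory is monomorphic if every model of it is a monomorphic structure. -/
def IsMonomorphicTheory (L : FirstOrder.Language.{u, v}) [L.IsRelational] (T : L.Theory) : Prop :=
  ∀ (M : Type w) [L.Structure M], M ⊨ T → IsMonomorphic L M

namespace MonomorphicTheory

open FirstOrder.Language FirstOrder.Language.Structure

section Words

/-- Two binary relations on the domain are compatible if tuples with the same pattern with respect
to them satisfy the same relations. Taking both equal to a strict order `r` says that `r` chains
the structure. -/
def OrderCompatible (L : FirstOrder.Language.{u, v}) {M : Type w} [L.Structure M]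
    (r s : M → M → Prop) : Prop :=
  ∀ ⦃m : ℕ⦄ (R : L.Relations m) (a b : Fin m → M),
    (∀ i j, r (a i) (a j) ↔ s (b i) (b j)) → (RelMap R a ↔ RelMap R b)

/-- Two words in the same letters are equivalent if replacing the letters of each of them, in
order, by an increasing sequence yields isomorphic structures on the set of letters. -/
def WordEquiv (L : FirstOrder.Language.{u, v}) {M : Type w} [L.Structure M]
    (r : M → M → Prop) (w₁ w₂ : List M) : Prop :=
  ∀ e₁ e₂ : M → M, (w₁.map e₁).Pairwise r → (w₂.map e₂).Pairwise r →
    ∀ ⦃m : ℕ⦄ (R : L.Relations m) (f : Fin m → M), (∀ i, f i ∈ w₁) →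
      (RelMap R (e₁ ∘ f) ↔ RelMap R (e₂ ∘ f))

/-- The first `j` letters of every word may be permuted arbitrarily. -/
def FreePrefix (L : FirstOrder.Language.{u, v}) {M : Type w} [L.Structure M]
    (r : M → M → Prop) (j : ℕ) : Prop :=
  ∀ x y F : List M, x.Perm y → x.length = j → (x ++ F).Nodup → WordEquiv L r (x ++ F) (y ++ F)

/-- Every word may be rotated. -/
def Rotatable (L : FirstOrder.Language.{u, v}) {M : Type w} [L.Structure M]
    (r : M → M → Prop) : Prop :=
  ∀ (z : M) (D : List M), (z :: D).Nodup → WordEquiv L r (z :: D) (D ++ [z])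

variable {M : Type w}

theorem pairwise_rel_iff {p q : M → M → Prop} (hp : ∀ a b, p a b → ¬ p b a)
    (hq : ∀ a b, q a b → ¬ q b a) {l : List M} (hlp : l.Pairwise p) (hlq : l.Pairwise q)
    {a b : M} (ha : a ∈ l) (hb : b ∈ l) : p a b ↔ q a b := by
  have h : a = b ∨ (p a b ∧ q a b) ∨ (p b a ∧ q b a) := by
    have : Std.Symm fun a b => a = b ∨ (p a b ∧ q a b) ∨ (p b a ∧ q b a) :=
      ⟨fun a b h => by tauto⟩
    refine List.Pairwise.forall_of_forall (R := fun a b => a = b ∨ (p a b ∧ q a b) ∨ (p b a ∧ q b a))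
      (fun _ _ => Or.inl rfl) ?_ ha hb
    exact (hlp.and hlq).imp fun h => Or.inr (Or.inl h)
  rcases h with rfl | h | h
  · exact ⟨fun h => (hp _ _ h h).elim, fun h => (hq _ _ h h).elim⟩
  · exact ⟨fun _ => h.2, fun _ => h.1⟩
  · exact ⟨fun h' => (hp _ _ h' h.1).elim, fun h' => (hq _ _ h' h.2).elim⟩

theorem pairwise_rel_nodup {r : M → M → Prop} [IsStrictTotalOrder M r] {l : List M}
    (h : l.Pairwise r) : l.Nodup :=
  List.Pairwise.imp (fun hab => ne_of_irrefl hab) h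

theorem exists_sorted_list (r : M → M → Prop) [IsStrictTotalOrder M r] (s : Finset M) :
    ∃ l : List M, l.Pairwise r ∧ (∀ a, a ∈ l ↔ a ∈ s) ∧ l.length = s.card := by
  classical
  let := linearOrderOfSTO r
  refine ⟨s.sort (· ≤ ·), ?_, by simp, by simp⟩
  exact (Finset.sortedLT_sort s).pairwise

theorem exists_map_eq {l₁ l₂ : List M} (h : l₁.Nodup) (hl : l₁.length = l₂.length) :
    ∃ f : M → M, l₁.map f = l₂ := by
  classical
  induction l₁ generalizing l₂ with
  | nil => exact ⟨id, by cases l₂ <;> simp_all⟩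
  | cons a l ih =>
    cases l₂ with
    | nil => simp at hl
    | cons b k =>
      obtain ⟨f, hf⟩ := ih (List.nodup_cons.1 h).2 (by simpa using hl)
      refine ⟨Function.update f a b, ?_⟩
      have : l.map (Function.update f a b) = l.map f :=
        List.map_congr_left fun c hc => Function.update_of_ne
          (ne_of_mem_of_not_mem hc (List.nodup_cons.1 h).1) _ _
      simp [this, hf]

theorem exists_increasing (r : M → M → Prop) [IsStrictTotalOrder M r] [Infinite M]
    {l : List M} (h : l.Nodup) : ∃ e : M → M, (l.map e).Pairwise r := by
  obtain ⟨s, hs⟩ := Infinite.exists_subset_card_eq M l.length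
  obtain ⟨k, hk, -, hk'⟩ := exists_sorted_list r s
  obtain ⟨f, hf⟩ := exists_map_eq (l₂ := k) h (by omega)
  exact ⟨f, hf ▸ hk⟩

variable {L : FirstOrder.Language.{u, v}} [L.Structure M] {r s : M → M → Prop}

theorem OrderCompatible.swap (h : OrderCompatible L r s) :
    OrderCompatible L (Function.swap r) (Function.swap s) :=
  fun _ R a b hab => h R a b fun i j => hab j i

namespace WordEquiv

theorem of_perm {w₁ w₂ : List M} [IsStrictTotalOrder M r] [IsStrictTotalOrder M s]
    (hr : OrderCompatible L r r) (hrs : OrderCompatible L r s)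
    (h₁ : w₁.Pairwise r) (h₂ : w₂.Pairwise s) (hw : ∀ a, a ∈ w₁ → a ∈ w₂) :
    WordEquiv L r w₁ w₂ := by
  intro e₁ e₂ he₁ he₂ m R f hf
  rw [List.pairwise_map] at he₁ he₂
  have key₁ : RelMap R (e₁ ∘ f) ↔ RelMap R f := hr R _ _ fun i j =>
    pairwise_rel_iff (p := fun a b => r (e₁ a) (e₁ b)) (fun _ _ => asymm_of r)
      (fun _ _ => asymm_of r) he₁ h₁ (hf i) (hf j)
  have key₂ : RelMap R (e₂ ∘ f) ↔ RelMap R f := hrs R _ _ fun i j =>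
    pairwise_rel_iff (p := fun a b => r (e₂ a) (e₂ b)) (fun _ _ => asymm_of r)
      (fun _ _ => asymm_of s) he₂ h₂ (hw _ (hf i)) (hw _ (hf j))
  rw [key₁, key₂]

theorem refl [IsStrictTotalOrder M r] (hr : OrderCompatible L r r) (l : List M) :
    WordEquiv L r l l := by
  intro e₁ e₂ he₁ he₂ m R f hf
  rw [List.pairwise_map] at he₁ he₂
  exact hr R _ _ fun i j =>
    pairwise_rel_iff (p := fun a b => r (e₁ a) (e₁ b)) (q := fun a b => r (e₂ a) (e₂ b))
      (fun _ _ => asymm_of r) (fun _ _ => asymm_of r) he₁ he₂ (hf i) (hf j)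

theorem symm {w₁ w₂ : List M} (hp : w₁.Perm w₂) (h : WordEquiv L r w₁ w₂) :
    WordEquiv L r w₂ w₁ :=
  fun e₁ e₂ h₁ h₂ _ R f hf => (h e₂ e₁ h₂ h₁ R f fun i => hp.mem_iff.2 (hf i)).symm

theorem trans [IsStrictTotalOrder M r] [Infinite M] {w₁ w₂ w₃ : List M} (hp : w₁.Perm w₂)
    (hn : w₂.Nodup) (h : WordEquiv L r w₁ w₂) (h' : WordEquiv L r w₂ w₃) :
    WordEquiv L r w₁ w₃ := by
  intro e₁ e₃ h₁ h₃ m R f hf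
  obtain ⟨e₂, h₂⟩ := exists_increasing r hn
  exact (h e₁ e₂ h₁ h₂ R f hf).trans (h' e₂ e₃ h₂ h₃ R f fun i => hp.mem_iff.1 (hf i))

theorem map {w₁ w₂ : List M} (h : WordEquiv L r w₁ w₂) (g : M → M) :
    WordEquiv L r (w₁.map g) (w₂.map g) := by
  intro e₁ e₂ h₁ h₂ m R f hf
  choose f' hf' hff' using fun i => List.mem_map.1 (hf i)
  obtain rfl : f = g ∘ f' := funext fun i => (hff' i).symm
  exact h (e₁ ∘ g) (e₂ ∘ g) (by simpa using h₁) (by simpa using h₂) R f' hf'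

end WordEquiv

/-- Words of the shape `X E` and `Y E` with `X` and `Y` permutations of each other are, up to a free
permutation of all but the last letter of `X` and `Y`, of the shape `t q p E` and `t p q E`. -/
theorem FreePrefix.exists_last_two [IsStrictTotalOrder M r] {j : ℕ}
    (hfree : FreePrefix L r (j + 1)) {x y F : List M} {p q : M} (hpq : p ≠ q)
    (hp : (x ++ [p]).Perm (y ++ [q])) (hl : x.length = j + 1) (hn : (x ++ [p] ++ F).Nodup) :
    ∃ t : List M, t.length = j ∧ (x ++ [p]).Perm (t ++ [q, p]) ∧
      WordEquiv L r (x ++ [p] ++ F) (t ++ [q, p] ++ F) ∧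
      WordEquiv L r (y ++ [q] ++ F) (t ++ [p, q] ++ F) := by
  classical
  have hq : q ∈ x := by
    have : q ∈ x ++ [p] := hp.mem_iff.2 (by simp)
    simpa [hpq.symm] using this
  have hx : x.Perm (x.erase q ++ [q]) :=
    (List.perm_cons_erase hq).trans (List.perm_append_comm (l₁ := [q]))
  have hxp : (x ++ [p]).Perm (x.erase q ++ [q, p]) := by
    simpa using hx.append_right [p]
  have hy : y.Perm (x.erase q ++ [p]) := by
    have h1 : (y ++ [q]).Perm (x.erase q ++ [p] ++ [q]) := by
      refine hp.symm.trans (hxp.trans ?_)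
      simpa using (List.Perm.swap p q []).append_left (x.erase q)
    exact (List.perm_append_right_iff [q]).1 h1
  refine ⟨x.erase q, by rw [List.length_erase_of_mem hq, hl]; rfl, hxp, ?_, ?_⟩
  · have := hfree x (x.erase q ++ [q]) ([p] ++ F) hx hl (by simpa using hn)
    simpa using this
  · have hn' : (y ++ [q] ++ F).Nodup := ((hp.append_right F).nodup_iff).1 hn
    have hl' : y.length = j + 1 := by
      have := hp.length_eq
      simp at this; omega
    have := hfree y (x.erase q ++ [p]) ([q] ++ F) hy hl' (by simpa using hn')
    simpa using this

theorem freePrefix_one [IsStrictTotalOrder M r] (hr : OrderCompatible L r r) :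
    FreePrefix L r 1 := by
  intro x y F hp hl _
  obtain ⟨a, rfl⟩ := List.length_eq_one_iff.1 hl
  obtain rfl := List.perm_singleton.1 hp.symm
  exact WordEquiv.refl hr _

theorem exists_eq_append_singleton {x : List M} {j : ℕ} (h : x.length = j + 1) :
    ∃ x' p, x = x' ++ [p] ∧ x'.length = j := by
  have hx : x ≠ [] := by rintro rfl; simp at h
  exact ⟨x.dropLast, x.getLast hx, (List.dropLast_append_getLast hx).symm, by simp [h]⟩

/-- Two equivalent words `X E` and `Y E` in which `X` and `Y` end with different letters make all
shorter prefixes free. -/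
theorem wordEquiv_of_last_ne [IsStrictTotalOrder M r] [Infinite M] {j : ℕ}
    (hfree : FreePrefix L r (j + 1)) {x₁ x₂ F y₁ y₂ G : List M} {p q : M}
    (hpq : p ≠ q) (hx : (x₁ ++ [p]).Perm (x₂ ++ [q])) (hxl : x₁.length = j + 1)
    (hxn : (x₁ ++ [p] ++ F).Nodup) (hE : WordEquiv L r (x₁ ++ [p] ++ F) (x₂ ++ [q] ++ F))
    (hy : y₁.Perm y₂) (hyl : y₁.length = j + 2) (hyn : (y₁ ++ G).Nodup)
    (hlen : F.length = G.length) : WordEquiv L r (y₁ ++ G) (y₂ ++ G) := by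
  obtain ⟨y₁, p', rfl, hyl₁⟩ := exists_eq_append_singleton hyl
  obtain ⟨y₂, q', rfl, hyl₂⟩ := exists_eq_append_singleton (hy.length_eq ▸ hyl)
  by_cases hpq' : p' = q'
  · subst hpq'
    have := hfree y₁ y₂ ([p'] ++ G) ((List.perm_append_right_iff _).1 hy) hyl₁ (by simpa using hyn)
    simpa using this
  obtain ⟨t, ht, htp, hE₁, hE₂⟩ := hfree.exists_last_two hpq hx hxl hxn
  obtain ⟨t', ht', htp', hE₁', hE₂'⟩ := hfree.exists_last_two hpq' hy hyl₁ hyn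
  have hn : (t ++ [q, p] ++ F).Nodup := ((htp.append_right F).nodup_iff).1 hxn
  have hn' : (t' ++ [q', p'] ++ G).Nodup := ((htp'.append_right G).nodup_iff).1 hyn
  have hsw : ∀ (t : List M) (p q : M) (F : List M),
      (t ++ [q, p] ++ F).Perm (t ++ [p, q] ++ F) := fun t p q F =>
    ((List.Perm.swap p q []).append_left t).append_right F
  have hmid : WordEquiv L r (t ++ [q, p] ++ F) (t ++ [p, q] ++ F) := by
    refine WordEquiv.trans (htp.symm.append_right F) hxn (hE₁.symm (htp.append_right F)) ?_
    exact WordEquiv.trans (hx.append_right F) (((hx.append_right F).nodup_iff).1 hxn) hE hE₂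
  obtain ⟨g, hg⟩ := exists_map_eq (l₂ := t' ++ [q', p'] ++ G) hn (by simp [ht, ht', hlen])
  have hg' : t.map g = t' ∧ g q = q' ∧ g p = p' ∧ F.map g = G := by
    simp only [List.map_append, List.append_assoc] at hg
    obtain ⟨h1, h2⟩ := List.append_inj hg (by simp [ht, ht'])
    simpa [h1] using h2
  have hmid' : WordEquiv L r (t' ++ [q', p'] ++ G) (t' ++ [p', q'] ++ G) := by
    have := hmid.map g
    simpa [hg'] using this
  refine WordEquiv.trans (htp'.append_right G) hn' hE₁' ?_
  refine WordEquiv.trans (hsw _ _ _ _) (((hsw _ _ _ _).nodup_iff).1 hn') hmid' ?_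
  exact hE₂'.symm ((hy.symm.trans htp').append_right G |>.trans (hsw _ _ _ _))

theorem Rotatable.append_comm [IsStrictTotalOrder M r] [Infinite M] (hr : OrderCompatible L r r)
    (h : Rotatable L r) (x y : List M) (hn : (x ++ y).Nodup) :
    WordEquiv L r (x ++ y) (y ++ x) := by
  induction x generalizing y with
  | nil => simpa using WordEquiv.refl hr y
  | cons a x ih =>
    have hp : (a :: (x ++ y)).Perm (x ++ y ++ [a]) := List.perm_append_comm (l₁ := [a])
    have hrot : (x ++ (y ++ [a])).Nodup := by
      rw [← List.append_assoc]; exact hp.nodup_iff.1 hn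
    refine WordEquiv.trans hp (by simpa using hrot) (h a (x ++ y) hn) ?_
    simpa using ih (y ++ [a]) hrot

/-- If words may be rotated and their first two letters interchanged, then they may be permuted
arbitrarily. -/
theorem Rotatable.freePrefix [IsStrictTotalOrder M r] [Infinite M] (hr : OrderCompatible L r r)
    (h : Rotatable L r) (h2 : FreePrefix L r 2) (j : ℕ) : FreePrefix L r j := by
  induction j with
  | zero =>
    intro x y F hp hl _
    obtain rfl := List.length_eq_zero_iff.1 hl
    obtain rfl := List.nil_perm.1 hp
    exact WordEquiv.refl hr _
  | succ j ih =>
    cases j with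
    | zero => exact freePrefix_one hr
    | succ j =>
      intro x y F hp hl hn
      obtain ⟨x, p, rfl, hxl⟩ := exists_eq_append_singleton hl
      obtain ⟨y, q, rfl, hyl⟩ := exists_eq_append_singleton (hp.length_eq ▸ hl)
      by_cases hpq : p = q
      · subst hpq
        have := ih x y ([p] ++ F) ((List.perm_append_right_iff _).1 hp) hxl (by simpa using hn)
        simpa using this
      obtain ⟨t, ht, htp, hE₁, hE₂⟩ := ih.exists_last_two hpq hp hxl hn
      have hn₁ : (t ++ [q, p] ++ F).Nodup := ((htp.append_right F).nodup_iff).1 hn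
      have hsw : (t ++ [q, p] ++ F).Perm (t ++ [p, q] ++ F) :=
        ((List.Perm.swap p q []).append_left t).append_right F
      have hn₂ := hsw.nodup_iff.1 hn₁
      have hrot : ∀ l : List M, (t ++ l ++ F).Perm (l ++ (F ++ t)) := fun l => by
        rw [List.append_assoc, ← List.append_assoc l]; exact List.perm_append_comm
      refine WordEquiv.trans (htp.append_right F) hn₁ hE₁ ?_
      refine WordEquiv.trans (w₂ := [q, p] ++ (F ++ t)) (hrot _) ((hrot _).nodup_iff.1 hn₁) ?_ ?_
      · simpa using h.append_comm hr t ([q, p] ++ F) (by simpa using hn₁)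
      refine WordEquiv.trans (w₂ := [p, q] ++ (F ++ t))
        ((List.Perm.swap p q []).append_right _) ((hrot _).nodup_iff.1 hn₂)
        (h2 _ _ _ (List.Perm.swap p q []) rfl ((hrot _).nodup_iff.1 hn₁)) ?_
      refine WordEquiv.trans (w₂ := t ++ [p, q] ++ F) (hrot _).symm hn₂ ?_ ?_
      · refine WordEquiv.symm (hrot _) ?_
        simpa using h.append_comm hr t ([p, q] ++ F) (by simpa using hn₂)
      · exact hE₂.symm ((hp.symm.trans htp).append_right F |>.trans hsw)

end Words

section Automorphisms

variable {M : Type w} {L : FirstOrder.Language.{u, v}} [L.Structure M] {r s : M → M → Prop}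

/-- Every relation depends only on which coordinates are equal. -/
def EqualityDefinable (L : FirstOrder.Language.{u, v}) (M : Type w) [L.Structure M] : Prop :=
  ∀ ⦃m : ℕ⦄ (R : L.Relations m) (a b : Fin m → M),
    (∀ i j, a i = a j ↔ b i = b j) → (RelMap R a ↔ RelMap R b)

theorem exists_comp_eq {m : ℕ} {a b : Fin m → M} (h : ∀ i j, a i = a j → b i = b j) :
    ∃ f : M → M, b = f ∘ a := by
  classical
  refine ⟨fun x => if hx : ∃ i, a i = x then b hx.choose else x, funext fun i => ?_⟩
  have hx : ∃ j, a j = a i := ⟨i, rfl⟩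
  simp only [Function.comp, dif_pos hx]
  exact h _ _ hx.choose_spec.symm

theorem equalityDefinable_of_freePrefix [IsStrictTotalOrder M r]
    (h : ∀ j, FreePrefix L r j) : EqualityDefinable L M := by
  classical
  intro m R a b hab
  obtain ⟨f, rfl⟩ := exists_comp_eq fun i j => (hab i j).1
  obtain ⟨g, hg⟩ := exists_comp_eq fun i j => (hab i j).2
  have hgf : ∀ i, g (f (a i)) = a i := fun i => (congrFun hg i).symm
  obtain ⟨x, hx, hxm, -⟩ := exists_sorted_list r (Finset.univ.image a)
  obtain ⟨y, hy, hym, -⟩ := exists_sorted_list r (Finset.univ.image (f ∘ a))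
  have hyf : (y.map g).map f = y := by
    rw [List.map_map]
    refine (List.map_congr_left fun c hc => ?_).trans (List.map_id y)
    obtain ⟨i, -, rfl⟩ := Finset.mem_image.1 ((hym c).1 hc)
    simp [hgf]
  have hp : x.Perm (y.map g) := by
    refine (List.perm_ext_iff_of_nodup (pairwise_rel_nodup hx) ?_).2 fun c => ?_
    · exact List.Nodup.of_map f (hyf.symm ▸ pairwise_rel_nodup hy)
    · simp [hxm, hym, hgf]
  have key := h x.length x (y.map g) [] hp rfl (by simpa using pairwise_rel_nodup hx) id f
    (by simpa using hx) (by simpa [-List.map_map, hyf] using hy) R a (by simp [hxm])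
  simpa using key

theorem exists_freePrefix [IsStrictTotalOrder M r] (hr : OrderCompatible L r r)
    (h : ¬ EqualityDefinable L M) :
    ∃ a, FreePrefix L r (a + 1) ∧ ¬ FreePrefix L r (a + 2) := by
  classical
  have hex : ∃ j, ¬ FreePrefix L r (j + 1) := by
    by_contra! hall
    refine h (equalityDefinable_of_freePrefix (r := r) fun j => ?_)
    cases j with
    | zero =>
      intro x y F hp hl _
      obtain rfl := List.length_eq_zero_iff.1 hl
      obtain rfl := List.nil_perm.1 hp
      exact WordEquiv.refl hr _
    | succ j => exact hall j
  have h0 : Nat.find hex ≠ 0 := fun h0 => by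
    have := Nat.find_spec hex
    rw [h0] at this
    exact this (freePrefix_one hr)
  obtain ⟨a, ha⟩ := Nat.exists_eq_succ_of_ne_zero h0
  refine ⟨a, not_not.1 (Nat.find_min hex (m := a) (by omega)), ?_⟩
  have := Nat.find_spec hex
  rwa [ha] at this

/-- No point which is below a large subset of `C` in one order is above it in the other one. -/
def NoJump (r s : M → M → Prop) (C : Finset M) (n : ℕ) : Prop :=
  ∀ D ⊆ C, n ≤ D.card → ∀ z, (∀ d ∈ D, r z d) → ¬ ∀ d ∈ D, s d z

/-- Permuting the first `a + 2` letters of a word with at least `b` further letters is not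
allowed in general. -/
def NonFreePrefix (L : FirstOrder.Language.{u, v}) {M : Type w} [L.Structure M]
    (r : M → M → Prop) (a b : ℕ) : Prop :=
  ∃ x y F : List M, x.Perm y ∧ x.length = a + 2 ∧ F.length = b ∧ (x ++ F).Nodup ∧
    ¬ WordEquiv L r (x ++ F) (y ++ F)

theorem exists_nonFreePrefix {a : ℕ} (h : ¬ FreePrefix L r (a + 2)) :
    ∃ b, NonFreePrefix L r a b := by
  unfold FreePrefix at h
  push Not at h
  obtain ⟨x, y, F, hp, hl, hn, hw⟩ := h
  exact ⟨F.length, x, y, F, hp, hl, rfl, hn, hw⟩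

theorem exists_greatest (r : M → M → Prop) [IsStrictTotalOrder M r] {X : Finset M}
    (h : X.Nonempty) : ∃ p ∈ X, ∀ x ∈ X, x ≠ p → r x p := by
  classical
  let := linearOrderOfSTO r
  exact ⟨X.max' h, X.max'_mem h, fun x hx hne => lt_of_le_of_ne (X.le_max' x hx) hne⟩

theorem sorted_of_agree {C : Finset M} (hag : ∀ c ∈ C, ∀ d ∈ C, r c d → s c d) {l : List M}
    (hl : ∀ a ∈ l, a ∈ C) (h : l.Pairwise r) : l.Pairwise s :=
  h.imp_of_mem fun ha hb hab => hag _ (hl _ ha) _ (hl _ hb) hab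

/-- Compatible orders agree on the last of `a + 2` points below sufficiently many points of `C`. -/
theorem greatest_of_nonFreePrefix [IsStrictTotalOrder M r] [IsStrictTotalOrder M s] [Infinite M]
    (hr : OrderCompatible L r r) (hrs : OrderCompatible L r s) {C : Finset M}
    (hag : ∀ c ∈ C, ∀ d ∈ C, r c d → s c d) {a b : ℕ} (hfree : FreePrefix L r (a + 1))
    (hnot : NonFreePrefix L r a b) {X E : Finset M} (hX : X.card = a + 2) (hE : E.card = b)
    (hEC : E ⊆ C) (hXr : ∀ x ∈ X, ∀ e ∈ E, r x e) (hXs : ∀ x ∈ X, ∀ e ∈ E, s x e)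
    {p : M} (hp : p ∈ X) (hpr : ∀ x ∈ X, x ≠ p → r x p) : ∀ x ∈ X, x ≠ p → s x p := by
  classical
  obtain ⟨q, hq, hqs⟩ := exists_greatest s ⟨p, hp⟩
  by_cases hpq : p = q
  · subst hpq; exact hqs
  exfalso
  obtain ⟨y₁, y₂, G, hy, hyl, hGl, hyn, hw⟩ := hnot
  refine hw ?_
  obtain ⟨x₁, hx₁, hxm₁, hxl₁⟩ := exists_sorted_list r (X.erase p)
  obtain ⟨x₂, hx₂, hxm₂, hxl₂⟩ := exists_sorted_list s (X.erase q)
  obtain ⟨F, hF, hFm, hFl⟩ := exists_sorted_list r E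
  have h₁ : (x₁ ++ [p] ++ F).Pairwise r := by
    refine List.pairwise_append.2 ⟨List.pairwise_append.2 ⟨hx₁, by simp, ?_⟩, hF, ?_⟩
    · simp only [hxm₁, List.mem_singleton, Finset.mem_erase]
      rintro x ⟨hxp, hx⟩ _ rfl
      exact hpr x hx hxp
    · simp only [hxm₁, hFm, List.mem_append, List.mem_singleton, Finset.mem_erase]
      rintro x (hx | rfl) e he
      · exact hXr x hx.2 e he
      · exact hXr x hp e he
  have h₂ : (x₂ ++ [q] ++ F).Pairwise s := by
    refine List.pairwise_append.2 ⟨List.pairwise_append.2 ⟨hx₂, by simp, ?_⟩,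
      sorted_of_agree hag (fun e he => hEC ((hFm e).1 he)) hF, ?_⟩
    · simp only [hxm₂, List.mem_singleton, Finset.mem_erase]
      rintro x ⟨hxp, hx⟩ _ rfl
      exact hqs x hx hxp
    · simp only [hxm₂, hFm, List.mem_append, List.mem_singleton, Finset.mem_erase]
      rintro x (hx | rfl) e he
      · exact hXs x hx.2 e he
      · exact hXs x hq e he
  have hmem₁ : ∀ x, x ∈ x₁ ++ [p] ↔ x ∈ X := fun x => by
    simp only [hxm₁, List.mem_append, List.mem_singleton, Finset.mem_erase]
    by_cases hx : x = p <;> simp [hx, hp]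
  have hmem₂ : ∀ x, x ∈ x₂ ++ [q] ↔ x ∈ X := fun x => by
    simp only [hxm₂, List.mem_append, List.mem_singleton, Finset.mem_erase]
    by_cases hx : x = q <;> simp [hx, hq]
  have hperm : (x₁ ++ [p]).Perm (x₂ ++ [q]) := by
    refine (List.perm_ext_iff_of_nodup ?_ ?_).2 fun c => (hmem₁ c).trans (hmem₂ c).symm
    · exact (pairwise_rel_nodup h₁).of_append_left
    · exact (pairwise_rel_nodup h₂).of_append_left
  refine wordEquiv_of_last_ne hfree hpq hperm ?_ (pairwise_rel_nodup h₁)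
    (WordEquiv.of_perm hr hrs h₁ h₂ fun c hc => (hperm.append_right F).mem_iff.1 hc) hy hyl hyn ?_
  · rw [hxl₁, Finset.card_erase_of_mem hp, hX]; rfl
  · omega

/-- A point below a large subset of `C` in one order is above few elements of it in another. -/
theorem card_filter_le_of_below [IsStrictTotalOrder M r] [IsStrictTotalOrder M s] [Infinite M]
    [DecidableRel s]
    (hr : OrderCompatible L r r) (hrs : OrderCompatible L r s) {C : Finset M}
    (hag : ∀ c ∈ C, ∀ d ∈ C, r c d ↔ s c d) {a b n : ℕ} (hfree : FreePrefix L r (a + 1))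
    (hnot : NonFreePrefix L r a b) (hjump : NoJump r s C n) {D : Finset M} (hDC : D ⊆ C)
    (hD : n + b ≤ D.card) {z : M} (hz : ∀ d ∈ D, r z d) : (D.filter (s · z)).card ≤ a := by
  classical
  by_contra! hcard
  have hsplit := Finset.card_filter_add_card_filter_not (s := D) (s · z)
  by_cases hb : b ≤ (D.filter (fun d => ¬ s d z)).card
  · obtain ⟨Y, hY, hYc⟩ := Finset.exists_subset_card_eq (n := a + 1) hcard
    obtain ⟨E, hE, hEc⟩ := Finset.exists_subset_card_eq hb
    have hYD : ∀ y ∈ Y, y ∈ D ∧ s y z := fun y hy => by simpa using hY hy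
    have hED : ∀ e ∈ E, e ∈ D ∧ s z e := fun e he => by
      obtain ⟨h1, h2⟩ := Finset.mem_filter.1 (hE he)
      have hne : z ≠ e := ne_of_irrefl (hz e h1)
      refine ⟨h1, ?_⟩
      rcases trichotomous_of s z e with h | h | h
      · exact h
      · exact (hne h).elim
      · exact (h2 h).elim
    have hzY : z ∉ Y := fun h => irrefl_of s z (hYD z h).2
    obtain ⟨p, hp, hpr⟩ := exists_greatest r (X := Y) (Finset.card_pos.1 (by omega))
    have := greatest_of_nonFreePrefix hr hrs (fun c hc d hd => (hag c hc d hd).1) hfree hnot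
      (X := insert z Y) (by rw [Finset.card_insert_of_notMem hzY, hYc]) hEc
      (fun e he => hDC (hED e he).1) ?_ ?_ (Finset.mem_insert_of_mem hp) ?_ z
      (Finset.mem_insert_self _ _) (fun h => hzY (h ▸ hp))
    · exact asymm_of s this (hYD p hp).2
    · rintro x hx e he
      rcases Finset.mem_insert.1 hx with rfl | hx
      · exact hz e (hED e he).1
      · exact (hag x (hDC (hYD x hx).1) e (hDC (hED e he).1)).2
          (trans_of s (hYD x hx).2 (hED e he).2)
    · rintro x hx e he
      rcases Finset.mem_insert.1 hx with rfl | hx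
      · exact (hED e he).2
      · exact trans_of s (hYD x hx).2 (hED e he).2
    · rintro x hx hne
      rcases Finset.mem_insert.1 hx with rfl | hx
      · exact hz p (hYD p hp).1
      · exact hpr x hx hne
  · refine hjump (D.filter (s · z)) ((Finset.filter_subset _ _).trans hDC) (by omega) z
      (fun d hd => hz d (Finset.mem_filter.1 hd).1) fun d hd => (Finset.mem_filter.1 hd).2

/-- Compatible orders agree on pairs of points below a large subset of `C`. -/
theorem rel_of_below [IsStrictTotalOrder M r] [IsStrictTotalOrder M s] [Infinite M]
    (hr : OrderCompatible L r r) (hrs : OrderCompatible L r s) {C : Finset M}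
    (hag : ∀ c ∈ C, ∀ d ∈ C, r c d ↔ s c d) {a b n : ℕ} (hfree : FreePrefix L r (a + 1))
    (hnot : NonFreePrefix L r a b) (hjump : NoJump r s C n)
    (hC : ∀ y ∉ C, ∃ Z : Finset M, Z.card = a + 1 ∧ ∀ z ∈ Z, r z y) {D : Finset M} (hDC : D ⊆ C)
    (hD : n + b + (a + 2) * a ≤ D.card) {x y : M} (hy : ∀ d ∈ D, r y d) (hxy : r x y) :
    s x y := by
  classical
  by_cases hxyC : x ∈ C ∧ y ∈ C
  · exact (hag x hxyC.1 y hxyC.2).1 hxy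
  have hZ : ∃ Z : Finset M, Z.card = a + 1 ∧ ∀ z ∈ Z, r z y := by
    by_cases h : y ∈ C
    · obtain ⟨Z, hZ, hZ'⟩ := hC x fun hx => hxyC ⟨hx, h⟩
      exact ⟨Z, hZ, fun z hz => trans_of r (hZ' z hz) hxy⟩
    · exact hC y h
  obtain ⟨Z, hZc, hZy⟩ := hZ
  obtain ⟨W, hxW, hWZ, hWc⟩ := Finset.exists_subsuperset_card_eq (s := {x}) (t := insert x Z)
    (n := a + 1) (by simp) (by simp) (hZc ▸ Finset.card_le_card (Finset.subset_insert _ _))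
  have hWy : ∀ z ∈ W, r z y := fun z hz => by
    rcases Finset.mem_insert.1 (hWZ hz) with rfl | h
    · exact hxy
    · exact hZy z h
  have hyW : y ∉ W := fun h => irrefl_of r y (hWy y h)
  have hX : ∀ z ∈ insert y W, ∀ d ∈ D, r z d := fun z hz d hd => by
    rcases Finset.mem_insert.1 hz with rfl | h
    · exact hy d hd
    · exact trans_of r (hWy z h) (hy d hd)
  have hXc : (insert y W).card = a + 2 := by rw [Finset.card_insert_of_notMem hyW, hWc]
  have hbad : ((insert y W).biUnion fun z => D.filter (s · z)).card ≤ (a + 2) * a := by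
    rw [← hXc]
    exact Finset.card_biUnion_le_card_mul _ _ _ fun z hz =>
      card_filter_le_of_below hr hrs hag hfree hnot hjump hDC (by omega) (hX z hz)
  obtain ⟨E, hE, hEc⟩ := Finset.exists_subset_card_eq (n := b)
    (s := D \ (insert y W).biUnion fun z => D.filter (s · z)) (by
      have := Finset.le_card_sdiff ((insert y W).biUnion fun z => D.filter (s · z)) D
      omega)
  refine greatest_of_nonFreePrefix hr hrs (fun c hc d hd => (hag c hc d hd).1) hfree hnot hXc hEc
    (fun e he => hDC (Finset.mem_sdiff.1 (hE he)).1)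
    (fun z hz e he => hX z hz e (Finset.mem_sdiff.1 (hE he)).1) ?_ (Finset.mem_insert_self _ _) ?_ x
    (Finset.mem_insert_of_mem (hxW (by simp))) (ne_of_irrefl hxy)
  · intro z hz e he
    obtain ⟨h1, h2⟩ := Finset.mem_sdiff.1 (hE he)
    rcases trichotomous_of s z e with h | h | h
    · exact h
    · exact (ne_of_irrefl (hX z hz e h1) h).elim
    · exact (h2 (Finset.mem_biUnion.2 ⟨z, hz, Finset.mem_filter.2 ⟨h1, h⟩⟩)).elim
  · intro z hz hne
    exact hWy z ((Finset.mem_insert.1 hz).resolve_left hne)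

/-- All but finitely many points have at least `n` predecessors. -/
theorem exists_finset_predecessors (r : M → M → Prop) [IsStrictTotalOrder M r] (n : ℕ) :
    ∃ C : Finset M, ∀ y ∉ C, ∃ Z : Finset M, Z.card = n ∧ ∀ z ∈ Z, r z y := by
  classical
  induction n with
  | zero => exact ⟨∅, fun y _ => ⟨∅, by simp, by simp⟩⟩
  | succ n ih =>
    obtain ⟨C, hC⟩ := ih
    have hstep : ∀ y y', y' ∉ C → r y' y → ∃ Z : Finset M, Z.card = n + 1 ∧ ∀ z ∈ Z, r z y := by
      intro y y' hy' h
      obtain ⟨Z, hZ, hZ'⟩ := hC y' hy'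
      refine ⟨insert y' Z, ?_, ?_⟩
      · rw [Finset.card_insert_of_notMem fun h' => irrefl_of r y' (hZ' y' h'), hZ]
      · intro z hz
        rcases Finset.mem_insert.1 hz with rfl | hz
        · exact h
        · exact trans_of r (hZ' z hz) h
    by_cases hmin : ∃ y₀, y₀ ∉ C ∧ ∀ y ∉ C, ¬ r y y₀
    · obtain ⟨y₀, hy₀, hmin⟩ := hmin
      refine ⟨insert y₀ C, fun y hy => hstep y y₀ hy₀ ?_⟩
      rw [Finset.mem_insert, not_or] at hy
      rcases trichotomous_of r y₀ y with h | h | h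
      · exact h
      · exact (hy.1 h.symm).elim
      · exact (hmin y hy.2 h).elim
    · push Not at hmin
      refine ⟨C, fun y hy => ?_⟩
      obtain ⟨y', hy', h⟩ := hmin y hy
      exact hstep y y' hy' h

theorem noJump_of_not_rotatable [IsStrictTotalOrder M r] (hr : OrderCompatible L r r)
    (h : ¬ Rotatable L r) : ∃ n, ∀ s, IsStrictTotalOrder M s → OrderCompatible L r s →
      ∀ C : Finset M, (∀ c ∈ C, ∀ d ∈ C, r c d ↔ s c d) → NoJump r s C n ∧ NoJump s r C n := by
  unfold Rotatable at h
  push Not at h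
  obtain ⟨z₀, D₀, hn, hw⟩ := h
  refine ⟨D₀.length, fun s hs hrs C hag => ⟨?_, ?_⟩⟩ <;>
  · intro D hDC hD z hz hz'
    obtain ⟨E, hE, hEc⟩ := Finset.exists_subset_card_eq hD
    obtain ⟨l, hl, hlm, hll⟩ := exists_sorted_list r E
    have hls := sorted_of_agree (fun c hc d hd => (hag c hc d hd).1)
      (fun e he => hDC (hE ((hlm e).1 he))) hl
    have h₁ := fun e he => hz e (hE ((hlm e).1 he))
    have h₂ := fun e he => hz' e (hE ((hlm e).1 he))
    have hzl : (z :: l).Nodup := by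
      refine List.nodup_cons.2 ⟨fun hzl => ?_, pairwise_rel_nodup hl⟩
      exact (ne_of_irrefl (h₁ z hzl)) rfl
    have hp : (z :: l).Perm (l ++ [z]) := List.perm_append_comm (l₁ := [z])
    have hE : WordEquiv L r (z :: l) (l ++ [z]) := by
      first
      | exact WordEquiv.of_perm hr hrs (List.pairwise_cons.2 ⟨h₁, hl⟩)
          (List.pairwise_append.2 ⟨hls, by simp, by simpa using h₂⟩) fun c hc => hp.mem_iff.1 hc
      | exact WordEquiv.symm hp.symm <| WordEquiv.of_perm hr hrs
          (List.pairwise_append.2 ⟨hl, by simp, by simpa using h₂⟩)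
          (List.pairwise_cons.2 ⟨h₁, hls⟩) fun c hc => hp.mem_iff.2 hc
    obtain ⟨g, hg⟩ := exists_map_eq (l₂ := z₀ :: D₀) hzl (by simp [hll, hEc])
    simp only [List.map_cons, List.cons.injEq] at hg
    refine hw ?_
    have := hE.map g
    simpa [hg] using this

theorem noJump_of_rotatable [IsStrictTotalOrder M r] [Infinite M] (hr : OrderCompatible L r r)
    (h : Rotatable L r) (h2 : ¬ FreePrefix L r 2) {c : M} (hc : ∀ x, x ≠ c → r c x) :
    ∃ n, ∀ s, IsStrictTotalOrder M s → OrderCompatible L r s → (∀ x, x ≠ c → s c x) →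
      ∀ C : Finset M, (∀ c ∈ C, ∀ d ∈ C, r c d ↔ s c d) → NoJump r s C n ∧ NoJump s r C n := by
  obtain ⟨b, y₁, y₂, G, hy, hyl, hGl, hyn, hw⟩ := exists_nonFreePrefix (a := 0) h2
  refine ⟨b + 1, fun s hs hrs hcs C hag => ⟨?_, ?_⟩⟩ <;>
  · intro D hDC hD z hz hz'
    obtain ⟨E, hE, hEc⟩ := Finset.exists_subset_card_eq (n := b) (s := D) (by omega)
    obtain ⟨l, hl, hlm, hll⟩ := exists_sorted_list r E
    have hls := sorted_of_agree (fun c hc d hd => (hag c hc d hd).1)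
      (fun e he => hDC (hE ((hlm e).1 he))) hl
    have h₁ := fun e he => hz e (hE ((hlm e).1 he))
    have h₂ := fun e he => hz' e (hE ((hlm e).1 he))
    have hcD : c ∉ D := fun h => by
      have h1 := hz c h
      have h2 : z ≠ c := ne_of_irrefl h1
      first
      | exact asymm_of r h1 (hc z h2)
      | exact asymm_of s h1 (hcs z h2)
    have hzc : z ≠ c := by
      rintro rfl
      obtain ⟨d, hd⟩ := Finset.card_pos.1 (show 0 < D.card by omega)
      have hne : d ≠ z := fun h => hcD (h ▸ hd)
      first
      | exact asymm_of s (hz' d hd) (hcs d hne)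
      | exact asymm_of r (hz' d hd) (hc d hne)
    have hcl : ∀ e ∈ l, e ≠ c := fun e he h => hcD (h ▸ hE ((hlm e).1 he))
    have hzl : ([c] ++ [z] ++ l).Nodup := by
      have h3 : z ∉ l := fun h3 => (ne_of_irrefl (h₁ z h3)) rfl
      have h4 : c ∉ l := fun h => hcl c h rfl
      simp [h3, h4, hzc.symm, pairwise_rel_nodup hl]
    have hp : ([c] ++ [z] ++ l).Perm (([c] ++ l) ++ [z]) := by
      simpa using List.perm_append_comm (l₁ := [z])
    have hq : (([c] ++ l) ++ [z]).Perm ([z] ++ ([c] ++ l)) := List.perm_append_comm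
    have hE : WordEquiv L r ([c] ++ [z] ++ l) (([c] ++ l) ++ [z]) := by
      first
      | refine WordEquiv.of_perm hr hrs ?_ ?_ fun c hc => hp.mem_iff.1 hc
        · refine List.pairwise_cons.2 ⟨fun x hx => hc x ?_, List.pairwise_cons.2 ⟨h₁, hl⟩⟩
          rcases List.mem_cons.1 hx with rfl | hx
          exacts [hzc, hcl x hx]
        · refine List.pairwise_append.2 ⟨?_, by simp, ?_⟩
          · simp only [List.singleton_append, List.pairwise_cons]
            exact ⟨fun x hx => hcs x (hcl x hx), hls⟩
          · rintro x hx y hy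
            obtain rfl := List.mem_singleton.1 hy
            rcases List.mem_cons.1 hx with rfl | hx
            exacts [hcs _ hzc, h₂ x hx]
      | refine WordEquiv.symm hp.symm <| WordEquiv.of_perm hr hrs ?_ ?_ fun c hc => hp.mem_iff.2 hc
        · refine List.pairwise_append.2 ⟨?_, by simp, ?_⟩
          · simp only [List.singleton_append, List.pairwise_cons]
            exact ⟨fun x hx => hc x (hcl x hx), hl⟩
          · rintro x hx y hy
            obtain rfl := List.mem_singleton.1 hy
            rcases List.mem_cons.1 hx with rfl | hx
            exacts [hc _ hzc, h₂ x hx]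
        · refine List.pairwise_cons.2 ⟨fun x hx => hcs x ?_, List.pairwise_cons.2 ⟨h₁, hls⟩⟩
          rcases List.mem_cons.1 hx with rfl | hx
          exacts [hzc, hcl x hx]
    have hE' : WordEquiv L r ([c] ++ [z] ++ l) ([z] ++ [c] ++ l) := by
      refine WordEquiv.trans hp (hp.nodup_iff.1 hzl) hE ?_
      simpa using h.append_comm hr ([c] ++ l) [z] (hp.nodup_iff.1 hzl)
    refine hw (wordEquiv_of_last_ne (j := 0) (freePrefix_one hr) hzc ?_ rfl hzl hE' hy hyl hyn
      (by omega))
    exact List.Perm.swap _ _ _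

end Automorphisms

section AutomorphismsFixing

variable {M : Type w} {L : FirstOrder.Language.{u, v}} [L.Structure M] {r s : M → M → Prop}

theorem isStrictTotalOrder_comp [IsStrictTotalOrder M r] {g : M → M} (hg : Function.Injective g) :
    IsStrictTotalOrder M fun x y => r (g x) (g y) where
  trichotomous _ _ h h' := hg (Std.Trichotomous.trichotomous (r := r) _ _ h h')
  irrefl x := irrefl_of r (g x)
  trans _ _ _ := trans_of r

theorem OrderCompatible.comp_equiv (hr : OrderCompatible L r r) (g : M ≃[L] M) :
    OrderCompatible L r fun x y => r (g x) (g y) := fun _ R a b hab =>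
  (hr R a (g ∘ b) hab).trans (StrongHomClass.map_rel g R b)

theorem rel_of_not_rel_swap [IsStrictTotalOrder M r] {x y : M} (hne : x ≠ y) (h : ¬ r y x) :
    r x y := by
  rcases trichotomous_of r x y with h' | h' | h'
  · exact h'
  · exact (hne h').elim
  · exact (h h').elim

/-- If no automorphism moves a point across a large set of fixed points, then the automorphisms
fixing a suitable finite set preserve the order. -/
theorem exists_finset_preserving [IsStrictTotalOrder M r] [Infinite M]
    (hr : OrderCompatible L r r) (hL : ¬ EqualityDefinable L M) {n : ℕ} {C₀ : Finset M}
    (hjump : ∀ (g : M ≃[L] M) (C : Finset M), C₀ ⊆ C → (∀ c ∈ C, g c = c) →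
      NoJump r (fun x y => r (g x) (g y)) C n ∧ NoJump (fun x y => r (g x) (g y)) r C n) :
    ∃ C : Finset M, ∀ g : M ≃[L] M, (∀ c ∈ C, g c = c) → ∀ x y, r x y → r (g x) (g y) := by
  classical
  obtain ⟨a, hfree, hnot⟩ := exists_freePrefix hr hL
  obtain ⟨b, hb⟩ := exists_nonFreePrefix hnot
  obtain ⟨a', hfree', hnot'⟩ := exists_freePrefix hr.swap hL
  obtain ⟨b', hb'⟩ := exists_nonFreePrefix hnot'
  obtain ⟨C₁, hC₁⟩ := exists_finset_predecessors r (a + 1)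
  obtain ⟨C₂, hC₂⟩ := exists_finset_predecessors (Function.swap r) (a' + 1)
  obtain ⟨N, hN⟩ : ∃ N, N = n + b + (a + 2) * a + (n + b' + (a' + 2) * a') + a + a' + 1 := ⟨_, rfl⟩
  obtain ⟨K, hK⟩ := Infinite.exists_subset_card_eq M (3 * N + 2)
  refine ⟨C₀ ∪ C₁ ∪ C₂ ∪ K, fun g hg x y hxy => ?_⟩
  generalize hC : C₀ ∪ C₁ ∪ C₂ ∪ K = C at hg
  have hC₀ : C₀ ⊆ C := by rw [← hC]; intro z; simp +contextual
  have hC₁' : ∀ y ∉ C, ∃ Z : Finset M, Z.card = a + 1 ∧ ∀ z ∈ Z, r z y := fun y hy =>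
    hC₁ y fun h => hy (by rw [← hC]; simp [h])
  have hC₂' : ∀ y ∉ C, ∃ Z : Finset M, Z.card = a' + 1 ∧ ∀ z ∈ Z, r y z := fun y hy =>
    hC₂ y fun h => hy (by rw [← hC]; simp [h])
  have hCK : 3 * N + 2 ≤ C.card := hK ▸ Finset.card_le_card (by rw [← hC]; intro z; simp +contextual)
  have hs : IsStrictTotalOrder M fun x y => r (g x) (g y) := isStrictTotalOrder_comp g.injective
  have hrs := hr.comp_equiv g
  obtain ⟨hj, hj'⟩ := hjump g C hC₀ hg
  generalize hs' : (fun x y => r (g x) (g y)) = s at hs hrs hj hj'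
  have hag : ∀ c ∈ C, ∀ d ∈ C, r c d ↔ s c d := fun c hc d hd => by
    rw [← hs']; simp only [hg c hc, hg d hd]
  suffices s x y by rwa [← hs'] at this
  have hcover : C ⊆ C.filter (r y ·) ∪ C.filter (r · x) ∪ C.filter (fun d => r x d ∧ r d y) ∪
      {x, y} := by
    intro d hd
    simp only [Finset.mem_union, Finset.mem_filter, Finset.mem_insert, Finset.mem_singleton, hd,
      true_and]
    rcases trichotomous_of r x d with h | h | h <;> rcases trichotomous_of r d y with h' | h' | h' <;>
      tauto
  have hcard := (Finset.card_le_card hcover).trans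
    ((Finset.card_union_le _ _).trans (Nat.add_le_add (Finset.card_union_le _ _)
      Finset.card_le_two))
  have hcard' := Finset.card_union_le (C.filter (r y ·)) (C.filter (r · x))
  have hcases : N ≤ (C.filter (r y ·)).card ∨ N ≤ (C.filter (r · x)).card ∨
      N ≤ (C.filter (fun d => r x d ∧ r d y)).card := by omega
  have hjs : NoJump (Function.swap r) (Function.swap s) C n :=
    fun D hD hDn z h1 h2 => hj' D hD hDn z h2 h1
  rcases hcases with h | h | h
  · exact rel_of_below hr hrs hag hfree hb hj hC₁' (Finset.filter_subset _ _)
      (le_trans (by omega) h) (fun d hd => (Finset.mem_filter.1 hd).2) hxy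
  · exact rel_of_below (r := Function.swap r) (s := Function.swap s) hr.swap hrs.swap
      (fun c hc d hd => hag d hd c hc) hfree' hb' hjs hC₂' (Finset.filter_subset _ _)
      (le_trans (by omega) h) (fun d hd => (Finset.mem_filter.1 hd).2) hxy
  · have h1 := card_filter_le_of_below hr hrs hag hfree hb hj (Finset.filter_subset _ _)
      (le_trans (by omega) h) (z := x) (fun d hd => (Finset.mem_filter.1 hd).2.1)
    have h2 := card_filter_le_of_below (r := Function.swap r) (s := Function.swap s) hr.swap
      hrs.swap (fun c hc d hd => hag d hd c hc) hfree' hb' hjs (Finset.filter_subset _ _)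
      (le_trans (by omega) h) (z := y) (fun d hd => (Finset.mem_filter.1 hd).2.2)
    generalize hD : C.filter (fun d => r x d ∧ r d y) = D at h h1 h2
    obtain ⟨d, hd, hd'⟩ := Finset.exists_mem_notMem_of_card_lt_card (s := D.filter (s · x) ∪
      D.filter (Function.swap s · y)) (t := D) (by
        have := Finset.card_union_le (D.filter (s · x)) (D.filter (Function.swap s · y))
        omega)
    have hdr : r x d ∧ r d y := by rw [← hD] at hd; exact (Finset.mem_filter.1 hd).2
    simp only [Finset.mem_union, Finset.mem_filter, hd, true_and, not_or] at hd'
    exact trans_of s (rel_of_not_rel_swap (ne_of_irrefl hdr.1) hd'.1)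
      (rel_of_not_rel_swap (ne_of_irrefl hdr.2) hd'.2)

theorem OrderCompatible.right_self [IsStrictTotalOrder M r] [IsStrictTotalOrder M s] [Infinite M]
    (h : OrderCompatible L r s) : OrderCompatible L s s := by
  classical
  intro m R a b hab
  obtain ⟨l, hl, hlm, -⟩ := exists_sorted_list s (Finset.univ.image a)
  obtain ⟨e, he⟩ := exists_increasing r (pairwise_rel_nodup hl)
  have key : ∀ i j, r (e (a i)) (e (a j)) ↔ s (a i) (a j) := fun i j =>
    pairwise_rel_iff (p := fun x y => r (e x) (e y)) (fun _ _ => asymm_of r) (fun _ _ => asymm_of s)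
      (List.pairwise_map.1 he) hl (by simp [hlm]) (by simp [hlm])
  exact (h R (e ∘ a) a key).symm.trans (h R (e ∘ a) b fun i j => (key i j).trans (hab i j))

/-- The order obtained from `r` by moving the points below `c` to the end. -/
def rotate (r : M → M → Prop) (c : M) (x y : M) : Prop :=
  (¬ r x c ∧ r y c) ∨ (r x y ∧ (r x c ↔ r y c))

theorem isStrictTotalOrder_rotate (r : M → M → Prop) [IsStrictTotalOrder M r] (c : M) :
    IsStrictTotalOrder M (rotate r c) where
  trichotomous x y h h' := by
    refine Std.Trichotomous.trichotomous (r := r) x y ?_ ?_ <;> unfold rotate at h h' <;> tauto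
  irrefl x h := by
    have := irrefl_of r x
    unfold rotate at h; tauto
  trans x y z h h' := by
    have : r x y → r y z → r x z := trans_of r
    unfold rotate at *; tauto

theorem Rotatable.orderCompatible_rotate [IsStrictTotalOrder M r] [Infinite M]
    (hr : OrderCompatible L r r) (h : Rotatable L r) (c : M) :
    OrderCompatible L r (rotate r c) := by
  classical
  have := isStrictTotalOrder_rotate r c
  intro m R a b hab
  have heq : ∀ i j, b i = b j → a i = a j := fun i j hij =>
    Std.Trichotomous.trichotomous (r := r) _ _ (fun h' => irrefl_of (rotate r c) (b j)
      (by simpa [hij] using (hab i j).1 h')) (fun h' => irrefl_of (rotate r c) (b j)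
      (by simpa [hij] using (hab j i).1 h'))
  obtain ⟨f, rfl⟩ := exists_comp_eq heq
  obtain ⟨l₁, hl₁, hm₁, -⟩ := exists_sorted_list r ((Finset.univ.image b).filter (r · c))
  obtain ⟨l₂, hl₂, hm₂, -⟩ := exists_sorted_list r ((Finset.univ.image b).filter (¬ r · c))
  have hm₁' : ∀ x ∈ l₁, r x c := fun x hx => (Finset.mem_filter.1 ((hm₁ x).1 hx)).2
  have hm₂' : ∀ x ∈ l₂, ¬ r x c := fun x hx => (Finset.mem_filter.1 ((hm₂ x).1 hx)).2
  have hsort : (l₁ ++ l₂).Pairwise r := by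
    refine List.pairwise_append.2 ⟨hl₁, hl₂, fun x hx y hy => ?_⟩
    have h1 := hm₁' x hx
    have h2 := hm₂' y hy
    rcases trichotomous_of r x y with h' | h' | h'
    · exact h'
    · exact (h2 (h' ▸ h1)).elim
    · exact (h2 (trans_of r h' h1)).elim
  have hsort' : (l₂ ++ l₁).Pairwise (rotate r c) := by
    refine List.pairwise_append.2 ⟨hl₂.imp_of_mem fun hx hy hxy => Or.inr ⟨hxy, ?_⟩,
      hl₁.imp_of_mem fun hx hy hxy => Or.inr ⟨hxy, ?_⟩,
      fun x hx y hy => Or.inl ⟨hm₂' x hx, hm₁' y hy⟩⟩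
    · simp [hm₂' _ hx, hm₂' _ hy]
    · simp [hm₁' _ hx, hm₁' _ hy]
  have hf : ((l₂ ++ l₁).map f).Pairwise r := by
    refine List.pairwise_map.2 (hsort'.imp_of_mem fun {x y} hx hy hxy => ?_)
    have hmem : ∀ x ∈ l₂ ++ l₁, ∃ i, b i = x := fun x hx => by
      rcases List.mem_append.1 hx with hx | hx
      · simpa using (Finset.mem_filter.1 ((hm₂ x).1 hx)).1
      · simpa using (Finset.mem_filter.1 ((hm₁ x).1 hx)).1
    obtain ⟨i, rfl⟩ := hmem x hx
    obtain ⟨j, rfl⟩ := hmem y hy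
    exact (hab i j).2 hxy
  exact (h.append_comm hr l₁ l₂ (pairwise_rel_nodup hsort) id f (by simpa using hsort) hf R b
    (fun i => by by_cases hi : r (b i) c <;> simp [hm₁, hm₂, hi])).symm

/-- A chained structure whose relations are not definable from equality alone is chained by an order
preserved by all automorphisms which fix a certain finite set. -/
theorem exists_order_preserved [IsStrictTotalOrder M r] [Infinite M]
    (hr : OrderCompatible L r r) (hL : ¬ EqualityDefinable L M) :
    ∃ s : M → M → Prop, IsStrictTotalOrder M s ∧ OrderCompatible L s s ∧ ∃ C : Finset M,
      ∀ g : M ≃[L] M, (∀ c ∈ C, g c = c) → ∀ x y, s x y → s (g x) (g y) := by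
  by_cases hrot : ∃ s : M → M → Prop, IsStrictTotalOrder M s ∧ OrderCompatible L s s ∧
      ¬ Rotatable L s
  · obtain ⟨s, hs, hss, hrot⟩ := hrot
    refine ⟨s, hs, hss, ?_⟩
    obtain ⟨n, hn⟩ := noJump_of_not_rotatable hss hrot
    refine exists_finset_preserving hss hL (n := n) (C₀ := ∅) fun g C _ hg => ?_
    exact hn _ (isStrictTotalOrder_comp g.injective) (hss.comp_equiv g) C
      fun c hc d hd => by simp only [hg c hc, hg d hd]
  · push Not at hrot
    obtain ⟨c⟩ := (inferInstance : Nonempty M)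
    have hs := isStrictTotalOrder_rotate r c
    have hss := ((hrot r inferInstance hr).orderCompatible_rotate hr c).right_self
    have hsr := hrot _ hs hss
    refine ⟨rotate r c, hs, hss, ?_⟩
    have hc : ∀ x, x ≠ c → rotate r c c x := fun x hx => by
      have := irrefl_of r c
      rcases trichotomous_of r x c with h | h | h
      · exact Or.inl ⟨this, h⟩
      · exact (hx h).elim
      · exact Or.inr ⟨h, by simp [this, asymm_of r h]⟩
    obtain ⟨n, hn⟩ := noJump_of_rotatable hss hsr
      (fun h2 => hL (equalityDefinable_of_freePrefix (hsr.freePrefix hss h2))) hc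
    refine exists_finset_preserving hss hL (n := n) (C₀ := {c}) fun g C hcC hg => ?_
    have hgc : g c = c := hg c (hcC (by simp))
    refine hn _ (isStrictTotalOrder_comp g.injective) (hss.comp_equiv g) (fun x hx => ?_) C
      fun c hc d hd => by simp only [hg c hc, hg d hd]
    rw [hgc]
    exact hc _ fun h => hx (g.injective (h.trans hgc.symm))

end AutomorphismsFixing

section Chaining

variable {M : Type w}

/-- The iterated limit of a property of lists along an ultrafilter. -/
def iteratedLimit (U : Ultrafilter M) (Q : List M → Prop) : ℕ → List M → Prop
  | 0, l => Q l
  | k + 1, l => ∀ᶠ x in U, iteratedLimit U Q k (l ++ [x])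

theorem eventually_iff_const (U : Ultrafilter M) (P : M → Prop) :
    ∀ᶠ x in U, (P x ↔ ∀ᶠ y in U, P y) := by
  by_cases h : ∀ᶠ y in U, P y
  · filter_upwards [h] with x hx
    simp [h, hx]
  · filter_upwards [Ultrafilter.eventually_not.2 h] with x hx
    simp [h, hx]

/-- A form of Ramsey's theorem for finitely many properties of lists. -/
theorem exists_indiscernible_list [Infinite M] {ι : Type x} [Finite ι] (Q : ι → List M → Prop)
    (n : ℕ) : ∃ l : List M, l.Nodup ∧ l.length = n ∧ ∀ (q : ι) (l₁ l₂ : List M), l₁.Sublist l →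
      l₂.Sublist l → l₁.length = l₂.length → (Q q l₁ ↔ Q q l₂) := by
  let U : Ultrafilter M := Filter.hyperfilter M
  have key : ∀ j, ∃ l : List M, l.Nodup ∧ l.length = j ∧ ∀ (q : ι) (k : Fin (n + 1)) (l₁ : List M),
      l₁.Sublist l → l₁.length ≤ k →
        (iteratedLimit U (Q q) (k - l₁.length) l₁ ↔ iteratedLimit U (Q q) k []) := by
    intro j
    induction j with
    | zero =>
      refine ⟨[], by simp, rfl, fun q k l₁ hl₁ _ => ?_⟩
      obtain rfl := List.sublist_nil.1 hl₁
      simp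
    | succ j ih =>
      obtain ⟨l, hn, hl, hQ⟩ := ih
      have h₁ : ∀ᶠ x in U, x ∉ l := by
        have : {x | x ∈ l}ᶜ ∈ Filter.hyperfilter M :=
          Filter.compl_mem_hyperfilter_of_finite (List.finite_toSet l)
        exact this
      have h₂ : ∀ᶠ x in U, ∀ (q : ι) (k : Fin (n + 1)), ∀ l₁ ∈ {l₁ : List M | l₁.Sublist l},
          l₁.length < k → (iteratedLimit U (Q q) (k - (l₁.length + 1)) (l₁ ++ [x]) ↔
            iteratedLimit U (Q q) (k - l₁.length) l₁) := by
        refine Filter.eventually_all.2 fun q => Filter.eventually_all.2 fun k =>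
          (Filter.eventually_all_finite ?_).2 fun l₁ _ => ?_
        · refine (List.finite_toSet l.sublists).subset fun l₁ hl₁ => ?_
          simpa using hl₁
        · by_cases hk : l₁.length < k
          · obtain ⟨d, hd⟩ : ∃ d, (k : ℕ) = l₁.length + 1 + d := ⟨_, (Nat.add_sub_cancel' hk).symm⟩
            have e1 : (k : ℕ) - l₁.length = d + 1 := by omega
            have e2 : (k : ℕ) - (l₁.length + 1) = d := by omega
            rw [e1, e2]
            filter_upwards [eventually_iff_const U fun x => iteratedLimit U (Q q) d (l₁ ++ [x])]
              with x hx _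
            exact hx
          · exact Filter.Eventually.of_forall fun x h => (hk h).elim
      obtain ⟨x, hx₁, hx₂⟩ := (h₁.and h₂).exists
      refine ⟨l ++ [x], ?_, by simp [hl], fun q k l₁ hl₁ hlk => ?_⟩
      · exact List.nodup_append.2 ⟨hn, by simp, by
          rintro a ha b hb rfl
          exact hx₁ (by simpa [List.mem_singleton.1 hb] using ha)⟩
      · obtain ⟨k₁, k₂, rfl, hk₁, hk₂⟩ := List.sublist_append_iff.1 hl₁
        rcases List.sublist_cons_iff.1 hk₂ with h | ⟨t, rfl, h⟩
        · obtain rfl := List.sublist_nil.1 h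
          simpa using hQ q k k₁ hk₁ (by simpa using hlk)
        · obtain rfl := List.sublist_nil.1 h
          have hlk' : k₁.length < k := by simpa using hlk
          have := (hx₂ q k k₁ hk₁ hlk').trans (hQ q k k₁ hk₁ hlk'.le)
          simpa using this
  obtain ⟨l, hn, hl, hQ⟩ := key n
  refine ⟨l, hn, hl, fun q l₁ l₂ h₁ h₂ h => ?_⟩
  have hle := h₁.length_le
  have k₁ := hQ q ⟨l₁.length, by omega⟩ l₁ h₁ le_rfl
  have k₂ := hQ q ⟨l₁.length, by omega⟩ l₂ h₂ h.symm.le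
  simp only [h, Nat.sub_self, iteratedLimit] at k₁ k₂
  exact k₁.trans k₂.symm

theorem pairwise_idxOf_lt [DecidableEq M] {l : List M} (h : l.Nodup) :
    l.Pairwise fun x y => l.idxOf x < l.idxOf y := by
  rw [List.pairwise_iff_getElem]
  intro i j hi hj hij
  rwa [h.idxOf_getElem, h.idxOf_getElem]

variable {L : FirstOrder.Language.{u, v}} [L.Structure M]

/-- On suitable finite sets of any size, finitely many relations are chained. -/
theorem exists_list_chained [Infinite M] [DecidableEq M] (𝓡 : Finset (Σ m, L.Relations m)) (n : ℕ) :
    ∃ l : List M, l.Nodup ∧ l.length = n ∧ ∀ R ∈ 𝓡, ∀ a b : Fin R.1 → M, (∀ i, a i ∈ l) →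
      (∀ i, b i ∈ l) → (∀ i j, l.idxOf (a i) < l.idxOf (a j) ↔ l.idxOf (b i) < l.idxOf (b j)) →
        (RelMap R.2 a ↔ RelMap R.2 b) := by
  obtain ⟨x₀⟩ := (inferInstance : Nonempty M)
  obtain ⟨l, hn, hl, hQ⟩ := exists_indiscernible_list (M := M)
    (ι := Σ R : 𝓡, Fin R.1.1 → Fin n)
    (fun q l => RelMap q.1.1.2 fun i => l.getD (q.2 i) x₀) n
  refine ⟨l, hn, hl, fun R hR a b ha hb hab => ?_⟩
  have hinj : ∀ x ∈ l, ∀ y, l.idxOf x = l.idxOf y → x = y := fun x hx y h =>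
    List.idxOf_inj hx |>.1 h
  obtain ⟨f, rfl⟩ : ∃ f : M → M, b = f ∘ a := exists_comp_eq fun i j hij => by
    refine hinj _ (hb i) _ ?_
    have h1 := hab i j
    have h2 := hab j i
    simp only [hij, lt_irrefl, false_iff] at h1 h2
    omega
  obtain ⟨k, hkl, hkm⟩ : ∃ k : List M, k.Sublist l ∧ ∀ x, x ∈ k ↔ ∃ i, a i = x := by
    classical
    refine ⟨l.filter fun x => ∃ i, a i = x, List.filter_sublist, fun x => ?_⟩
    simp only [List.mem_filter, decide_eq_true_eq, and_iff_right_iff_imp]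
    rintro ⟨i, rfl⟩
    exact ha i
  have hkf : (k.map f).Pairwise fun x y => l.idxOf x < l.idxOf y := by
    refine List.pairwise_map.2 (((pairwise_idxOf_lt hn).sublist hkl).imp_of_mem ?_)
    intro x y hx hy hxy
    obtain ⟨i, rfl⟩ := (hkm x).1 hx
    obtain ⟨j, rfl⟩ := (hkm y).1 hy
    exact (hab i j).1 hxy
  have hkfl : (k.map f).Sublist l := by
    have : IsStrictOrder M fun x y => l.idxOf x < l.idxOf y :=
      { irrefl := fun x => lt_irrefl _, trans := fun _ _ _ => lt_trans }
    refine List.sublist_of_subperm_of_pairwise ?_ hkf (pairwise_idxOf_lt hn)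
    refine List.subperm_of_subset (hkf.imp fun h => ne_of_irrefl h) fun x hx => ?_
    obtain ⟨y, hy, rfl⟩ := List.mem_map.1 hx
    obtain ⟨i, rfl⟩ := (hkm y).1 hy
    exact hb i
  have hidx : ∀ i, k.idxOf (a i) < k.length := fun i => List.idxOf_lt_length_of_mem ((hkm _).2 ⟨i, rfl⟩)
  have key := hQ ⟨⟨R, hR⟩, fun i => ⟨k.idxOf (a i), (hidx i).trans_le (hl ▸ hkl.length_le)⟩⟩ k
    (k.map f) hkl hkfl (by simp)
  have e₁ : (fun i => k.getD (k.idxOf (a i)) x₀) = a := funext fun i => by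
    rw [List.getD_eq_getElem _ _ (hidx i)]
    simp
  have e₂ : (fun i => (k.map f).getD (k.idxOf (a i)) x₀) = f ∘ a := funext fun i => by
    rw [List.getD_eq_getElem _ _ (by simpa using hidx i)]
    simp
  rwa [e₁, e₂] at key

variable [L.IsRelational]

/-- In a monomorphic structure finitely many relations are chained on any finite set. -/
theorem IsMonomorphic.exists_height [Infinite M] (hM : IsMonomorphic L M) (F : Finset M)
    (𝓡 : Finset (Σ m, L.Relations m)) :
    ∃ h : M → ℕ, Set.InjOn h F ∧ ∀ R ∈ 𝓡, ∀ a b : Fin R.1 → M, (∀ i, a i ∈ F) →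
      (∀ i, b i ∈ F) → (∀ i j, h (a i) < h (a j) ↔ h (b i) < h (b j)) →
        (RelMap R.2 a ↔ RelMap R.2 b) := by
  classical
  obtain ⟨l, hn, hl, hR⟩ := exists_list_chained (M := M) 𝓡 F.card
  obtain ⟨φ⟩ := hM F l.toFinset F.finite_toSet l.toFinset.finite_toSet (by
    rw [Set.ncard_coe_finset, Set.ncard_coe_finset, List.toFinset_card_of_nodup hn, hl])
  let := inducedStructure L (F : Set M)
  let := inducedStructure L (l.toFinset : Set M)
  have hφl : ∀ x, (φ x : M) ∈ l := fun x => by simpa using (φ x).2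
  have hφ : ∀ (R : Σ m, L.Relations m) (a : Fin R.1 → M) (ha : ∀ i, a i ∈ F),
      RelMap R.2 (fun i => (φ ⟨a i, ha i⟩ : M)) ↔ RelMap R.2 a := fun R a ha =>
    φ.map_rel' R.2 fun i => ⟨a i, ha i⟩
  refine ⟨fun x => if hx : x ∈ F then l.idxOf (φ ⟨x, hx⟩ : M) else 0, ?_, ?_⟩
  · intro x hx y hy hxy
    have hx' : x ∈ F := hx
    have hy' : y ∈ F := hy
    simp only [dif_pos hx', dif_pos hy'] at hxy
    have := φ.injective (Subtype.ext ((List.idxOf_inj (hφl _)).1 hxy))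
    exact congrArg Subtype.val this
  · intro R hRR a b ha hb hab
    rw [← hφ R a ha, ← hφ R b hb]
    refine hR R hRR _ _ (fun i => hφl _) (fun i => hφl _) fun i j => ?_
    simpa only [dif_pos (ha _), dif_pos (hb _)] using hab i j

/-- An infinite monomorphic structure is chained by some linear order. -/
theorem IsMonomorphic.exists_orderCompatible [Infinite M] (hM : IsMonomorphic L M) :
    ∃ r : M → M → Prop, IsStrictTotalOrder M r ∧ OrderCompatible L r r := by
  classical
  let I := Finset M × Finset (Σ m, L.Relations m)
  choose h hinj hrel using fun i : I =>
    IsMonomorphic.exists_height hM i.1 i.2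
  let V : Ultrafilter I := 
    Ultrafilter.of Filter.atTop
  have hV : (V : Filter I) ≤ Filter.atTop :=
    Ultrafilter.of_le _
  have hF : ∀ x : M, ∀ᶠ i : I in V, x ∈ i.1 := fun x => by
    filter_upwards [hV (Filter.eventually_ge_atTop ({x}, ∅))] with i hi
    exact hi.1 (by simp)
  have hpat : ∀ x y, ∀ᶠ i : I in V, (h i x < h i y ↔ ∀ᶠ j : I in V, h j x < h j y) := fun x y =>
    eventually_iff_const V fun i => h i x < h i y
  refine ⟨fun x y => ∀ᶠ i : I in V, h i x < h i y, { trichotomous := ?_, irrefl := ?_, trans := ?_ }, ?_⟩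
  · intro x y hxy hyx
    obtain ⟨i, ⟨⟨h1, h2⟩, h3⟩, h4⟩ := ((((Ultrafilter.eventually_not.2 hxy).and
      (Ultrafilter.eventually_not.2 hyx)).and (hF x)).and (hF y)).exists
    exact hinj i h3 h4 (by omega)
  · intro x hx
    obtain ⟨i, hi⟩ := hx.exists
    exact lt_irrefl _ hi
  · intro x y z hxy hyz
    filter_upwards [hxy, hyz] with i h1 h2
    exact h1.trans h2
  · intro m R a b hab
    have hR : ∀ᶠ i : I in V, (⟨m, R⟩ : Σ m, L.Relations m) ∈ i.2 := by
      filter_upwards [hV (Filter.eventually_ge_atTop (∅, {⟨m, R⟩}))] with i hi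
      exact hi.2 (by simp)
    obtain ⟨i, hi⟩ := (((hR.and (Filter.eventually_all.2 fun k => hF (a k))).and
      (Filter.eventually_all.2 fun k => hF (b k))).and
      ((Filter.eventually_all.2 fun k => Filter.eventually_all.2 fun k' => hpat (a k) (a k')).and
      (Filter.eventually_all.2 fun k => Filter.eventually_all.2 fun k' => hpat (b k) (b k')))).exists
    obtain ⟨⟨⟨h1, h2⟩, h3⟩, h4, h5⟩ := hi
    exact hrel i ⟨m, R⟩ h1 a b h2 h3 fun k k' =>
      (h4 k k').trans ((hab k k').trans (h5 k k').symm)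

end Chaining

section ChainFormulas

variable {L : FirstOrder.Language.{u, v}} {α : Type w} {ι : Type x} [Finite ι] {n : ℕ}

theorem isQF_iInf {f : ι → L.BoundedFormula α n} (hf : ∀ i, (f i).IsQF) :
    (BoundedFormula.iInf f).IsQF := by
  unfold BoundedFormula.iInf
  dsimp only
  generalize (@Finset.univ ι (Fintype.ofFinite ι)).toList = l
  induction l with
  | nil => exact BoundedFormula.IsQF.top
  | cons a l ih => exact (hf a).inf ih

theorem isQF_iSup {f : ι → L.BoundedFormula α n} (hf : ∀ i, (f i).IsQF) :
    (BoundedFormula.iSup f).IsQF := by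
  unfold BoundedFormula.iSup
  dsimp only
  generalize (@Finset.univ ι (Fintype.ofFinite ι)).toList = l
  induction l with
  | nil => exact BoundedFormula.isQF_bot
  | cons a l ih => exact (hf a).sup ih

/-- The atomic formula stating that the variable `i` precedes the variable `j`. -/
def ltFormula {β : Type*} (i j : β) : Language.order.Formula β :=
  leSymb.formula₂ (Term.var i) (Term.var j)

theorem realize_ltFormula {M : Type w} (lo : LinearOrder M) {β : Type*} (i j : β) (v : β → M) :
    @Formula.Realize _ _ (ltStructure lo) _ (ltFormula i j) v ↔ lo.lt (v i) (v j) := by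
  let := ltStructure lo
  simp only [ltFormula, Formula.realize_rel₂, Term.realize_var]
  rfl

theorem isQF_ltFormula {β : Type*} (i j : β) : (ltFormula i j).IsQF :=
  (BoundedFormula.IsAtomic.rel _ _).isQF

/-- The formula describing an order pattern. -/
noncomputable def patternFormula {m : ℕ} (P : Fin m × Fin m → Prop) :
    Language.order.Formula (Fin m) :=
  open Classical in
  BoundedFormula.iInf fun p : Fin m × Fin m =>
    if P p then ltFormula p.1 p.2 else BoundedFormula.not (ltFormula p.1 p.2)

theorem realize_patternFormula {M : Type w} (lo : LinearOrder M) {m : ℕ}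
    (P : Fin m × Fin m → Prop) (v : Fin m → M) :
    @Formula.Realize _ _ (ltStructure lo) _ (patternFormula P) v ↔
      ∀ p, (lo.lt (v p.1) (v p.2) ↔ P p) := by
  let := ltStructure lo
  unfold patternFormula Formula.Realize
  rw [BoundedFormula.realize_iInf]
  refine forall_congr' fun p => ?_
  have := realize_ltFormula lo p.1 p.2 v
  unfold Formula.Realize at this
  by_cases h : P p <;> simp [h, this]

theorem isQF_patternFormula {m : ℕ} (P : Fin m × Fin m → Prop) : (patternFormula P).IsQF := by
  refine isQF_iInf fun p => ?_
  split_ifs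
  · exact isQF_ltFormula _ _
  · exact (isQF_ltFormula _ _).not

theorem chains_of_orderCompatible {M : Type w} [L.Structure M] (lo : LinearOrder M)
    (h : OrderCompatible L lo.lt lo.lt) : Chains L lo := by
  intro m R
  refine ⟨BoundedFormula.iSup
    (fun P : {P : Fin m × Fin m → Prop //
      ∃ a : Fin m → M, RelMap R a ∧ ∀ p, (lo.lt (a p.1) (a p.2) ↔ P p)} => patternFormula P.1),
    isQF_iSup fun P => isQF_patternFormula P.1, fun v => ?_⟩
  let := ltStructure lo
  unfold Formula.Realize
  rw [BoundedFormula.realize_iSup]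
  constructor
  · intro hv
    exact ⟨⟨_, v, hv, fun p => Iff.rfl⟩, (realize_patternFormula lo _ v).2 fun p => Iff.rfl⟩
  · rintro ⟨⟨P, a, ha, haP⟩, hv⟩
    have hv' := (realize_patternFormula lo P v).1 hv
    refine (h R a v fun i j => ?_).1 ha
    exact (haP (i, j)).trans (hv' (i, j)).symm

end ChainFormulas

section Types

variable {L : FirstOrder.Language.{u, v}} {M : Type w} {N : Type w'} {α : Type*} {β : Type*}

/-- The universal closure of a formula with finitely many variables. -/
noncomputable def closeFormula [Finite α] (φ : L.Formula α) : L.Sentence :=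
  Formula.iAlls α (φ.relabel Sum.inr : L.Formula (Empty ⊕ α))

variable [L.Structure M] [L.Structure N]

theorem realize_closeFormula [Finite α] (φ : L.Formula α) :
    M ⊨ closeFormula φ ↔ ∀ v : α → M, φ.Realize v := by
  unfold closeFormula Sentence.Realize
  rw [Formula.realize_iAlls]
  refine forall_congr' fun v => ?_
  rw [Formula.realize_relabel]
  rfl

variable (L) in
/-- Two tuples, possibly in different structures, realize the same formulas. -/
def SameType (a : α → M) (b : α → N) : Prop :=
  ∀ φ : L.Formula α, φ.Realize a ↔ φ.Realize b

theorem SameType.comp {a : α → M} {b : α → N} (h : SameType L a b) (f : β → α) :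
    SameType L (a ∘ f) (b ∘ f) := fun φ => by
  simpa only [Formula.realize_relabel] using h (φ.relabel f)

theorem sameType_of_equiv (g : M ≃[L] N) (a : α → M) : SameType L a (g ∘ a) :=
  fun φ => (StrongHomClass.realize_formula g φ).symm

variable (M) in
/-- A formula whose realizations in `M` all have the same type. -/
def IsolatesType (ψ : L.Formula α) : Prop :=
  ∀ a b : α → M, ψ.Realize a → ψ.Realize b → SameType L a b

variable (L M) in
/-- For every `n` finitely many complete formulas cover the `n`-tuples of `M`. -/
def HasFinitelyManyTypes : Prop :=
  ∀ n : ℕ, ∃ Ψ : Set (L.Formula (Fin n)), Ψ.Finite ∧ (∀ ψ ∈ Ψ, IsolatesType M ψ) ∧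
    ∀ a : Fin n → M, ∃ ψ ∈ Ψ, ψ.Realize a

variable (L M) in
/-- For every `n` there are finitely many orbits of automorphisms on `n`-tuples. -/
def IsOligomorphic : Prop :=
  ∀ n : ℕ, ∃ A : Set (Fin n → M), A.Finite ∧ ∀ b, ∃ a ∈ A, ∃ g : M ≃[L] M, g ∘ a = b

theorem IsolatesType.relabel {ψ : L.Formula α} (h : IsolatesType M ψ) (e : α ≃ β) :
    IsolatesType M (ψ.relabel e) := by
  intro a b ha hb
  rw [Formula.realize_relabel] at ha hb
  have := (h _ _ ha hb).comp e.symm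
  simpa [Function.comp_assoc] using this

theorem HasFinitelyManyTypes.exists_formulas (h : HasFinitelyManyTypes L M) (α : Type*) [Finite α] :
    ∃ Ψ : Set (L.Formula α), Ψ.Finite ∧ (∀ ψ ∈ Ψ, IsolatesType M ψ) ∧
      ∀ a : α → M, ∃ ψ ∈ Ψ, ψ.Realize a := by
  obtain ⟨n, ⟨e⟩⟩ := Finite.exists_equiv_fin α
  obtain ⟨Ψ, hΨ, hi, hc⟩ := h n
  refine ⟨(fun ψ => ψ.relabel e.symm) '' Ψ, hΨ.image _, ?_, fun a => ?_⟩
  · rintro _ ⟨ψ, hψ, rfl⟩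
    exact (hi ψ hψ).relabel _
  · obtain ⟨ψ, hψ, ha⟩ := hc (a ∘ e.symm)
    exact ⟨_, ⟨ψ, hψ, rfl⟩, Formula.realize_relabel.2 ha⟩

theorem IsolatesType.sameType [Finite α] {ψ : L.Formula α} (h : IsolatesType M ψ)
    (hMN : L.ElementarilyEquivalent M N) {a : α → M} {b : α → N} (ha : ψ.Realize a)
    (hb : ψ.Realize b) : SameType L a b := by
  have key : ∀ φ : L.Formula α, φ.Realize a → φ.Realize b := by
    intro φ hφ
    have h1 : M ⊨ closeFormula (ψ.imp φ) := by
      rw [realize_closeFormula]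
      intro v
      rw [Formula.realize_imp]
      exact fun hv => (h a v ha hv φ).1 hφ
    have h2 := (elementarilyEquivalent_iff.1 hMN _).1 h1
    rw [realize_closeFormula] at h2
    exact Formula.realize_imp.1 (h2 b) hb
  refine fun φ => ⟨key φ, fun hφ => ?_⟩
  by_contra hn
  exact Formula.realize_not.1 (key φ.not (Formula.realize_not.2 hn)) hφ

theorem SameType.exists_extend [Finite α] (h : HasFinitelyManyTypes L M)
    (hMN : L.ElementarilyEquivalent M N) {a : α → M} {b : α → N} (hab : SameType L a b) (x : M) :
    ∃ y : N, SameType L (Sum.elim a fun _ : Unit => x) (Sum.elim b fun _ => y) := by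
  obtain ⟨Ψ, -, hi, hc⟩ := h.exists_formulas (α ⊕ Unit)
  obtain ⟨ψ, hψ, hx⟩ := hc (Sum.elim a fun _ => x)
  have h1 : (ψ.iExs Unit).Realize a := Formula.realize_iExs.2 ⟨_, hx⟩
  obtain ⟨y, hy⟩ := Formula.realize_iExs.1 ((hab _).1 h1)
  exact ⟨y (), (hi ψ hψ).sameType hMN hx hy⟩

theorem SameType.exists_extend' [Finite α] (h : HasFinitelyManyTypes L M)
    (hMN : L.ElementarilyEquivalent M N) {a : α → M} {b : α → N} (hab : SameType L a b) (y : N) :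
    ∃ x : M, SameType L (Sum.elim a fun _ : Unit => x) (Sum.elim b fun _ => y) := by
  obtain ⟨Ψ, hfin, hi, hc⟩ := h.exists_formulas (α ⊕ Unit)
  have := hfin.to_subtype
  have h1 : M ⊨ closeFormula (Formula.iSup fun ψ : Ψ => ψ.1) := by
    rw [realize_closeFormula]
    intro v
    obtain ⟨ψ, hψ, hv⟩ := hc v
    exact Formula.realize_iSup.2 ⟨⟨ψ, hψ⟩, hv⟩
  have h2 := (elementarilyEquivalent_iff.1 hMN _).1 h1
  rw [realize_closeFormula] at h2
  obtain ⟨⟨ψ, hψ⟩, hy⟩ := Formula.realize_iSup.1 (h2 (Sum.elim b fun _ => y))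
  have h3 : (ψ.iExs Unit).Realize b := Formula.realize_iExs.2 ⟨_, hy⟩
  obtain ⟨x, hx⟩ := Formula.realize_iExs.1 ((hab _).2 h3)
  exact ⟨x (), (hi ψ hψ).sameType hMN hx hy⟩

end Types

section BackAndForth

variable {L : FirstOrder.Language.{u, v}} {M : Type w} {N : Type w'}
variable [L.Structure M] [L.Structure N]

variable (L M N) in
/-- Finite partial elementary maps, given as sets of pairs. -/
abbrev FinitePartialElementary : Type (max w w') :=
  {s : Set (M × N) // s.Finite ∧ SameType L (fun p : s => p.1.1) (fun p : s => p.1.2)}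

theorem FinitePartialElementary.exists_insert (s : FinitePartialElementary L M N) {x : M} {y : N}
    (h : SameType L (Sum.elim (fun p : s.1 => p.1.1) fun _ : Unit => x)
      (Sum.elim (fun p : s.1 => p.1.2) fun _ => y)) :
    ∃ t : FinitePartialElementary L M N, s ≤ t ∧ (x, y) ∈ t.1 := by
  classical
  refine ⟨⟨insert (x, y) s.1, s.2.1.insert _, ?_⟩, Set.subset_insert _ _, Set.mem_insert _ _⟩
  convert h.comp (fun p : (insert (x, y) s.1 : Set (M × N)) =>
    if hp : p.1 ∈ s.1 then Sum.inl ⟨p.1, hp⟩ else Sum.inr ()) using 1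
  all_goals
    funext p
    by_cases hp : p.1 ∈ s.1
    · simp [hp]
    · simp only [Function.comp_apply, hp, dite_false, Sum.elim_inr]
      rw [p.2.resolve_right hp]

theorem SameType.exists_equiv [L.IsRelational] [Countable M] [Countable N]
    (h : HasFinitelyManyTypes L M) (hMN : L.ElementarilyEquivalent M N) {n : ℕ} {a : Fin n → M}
    {b : Fin n → N} (hab : SameType L a b) : ∃ g : M ≃[L] N, g ∘ a = b := by
  let P := FinitePartialElementary L M N
  have hfin : ∀ s : P, Finite s.1 := fun s => s.2.1.to_subtype
  let DM : M → Order.Cofinal P := fun x => ⟨{t | ∃ y, (x, y) ∈ t.1}, fun s => by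
    have := hfin s
    obtain ⟨y, hy⟩ := SameType.exists_extend h hMN s.2.2 x
    obtain ⟨t, hst, ht⟩ := s.exists_insert hy
    exact ⟨t, ⟨y, ht⟩, hst⟩⟩
  let DN : N → Order.Cofinal P := fun y => ⟨{t | ∃ x, (x, y) ∈ t.1}, fun s => by
    have := hfin s
    obtain ⟨x, hx⟩ := SameType.exists_extend' h hMN s.2.2 y
    obtain ⟨t, hst, ht⟩ := s.exists_insert hx
    exact ⟨t, ⟨x, ht⟩, hst⟩⟩
  have hinit : SameType L (fun p : Set.range (fun i => (a i, b i)) => p.1.1)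
      (fun p : Set.range (fun i => (a i, b i)) => p.1.2) := by
    have hc : ∀ p : Set.range (fun i => (a i, b i)), ∃ i, (a i, b i) = p.1 := fun p => p.2
    choose f hf using hc
    convert hab.comp f using 1
    · funext p; exact congrArg Prod.fst (hf p).symm
    · funext p; exact congrArg Prod.snd (hf p).symm
  let p₀ : P := ⟨_, Set.finite_range _, hinit⟩
  let : Encodable (M ⊕ N) := Encodable.ofCountable _
  let I := Order.idealOfCofinals p₀ (Sum.elim DM DN)
  have hM : ∀ x, ∃ y, ∃ s ∈ I, (x, y) ∈ s.1 := fun x => by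
    obtain ⟨s, ⟨y, hy⟩, hs⟩ := Order.cofinal_meets_idealOfCofinals p₀ (Sum.elim DM DN) (Sum.inl x)
    exact ⟨y, s, hs, hy⟩
  have hN : ∀ y, ∃ x, ∃ s ∈ I, (x, y) ∈ s.1 := fun y => by
    obtain ⟨s, ⟨x, hx⟩, hs⟩ := Order.cofinal_meets_idealOfCofinals p₀ (Sum.elim DM DN) (Sum.inr y)
    exact ⟨x, s, hs, hx⟩
  have hall : ∀ (k : ℕ) (c : Fin k → M) (d : Fin k → N),
      (∀ i, ∃ s ∈ I, (c i, d i) ∈ s.1) → SameType L c d := by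
    intro k c d hcd
    choose s hs hcs using hcd
    obtain ⟨t, ht, hst⟩ : ∃ t ∈ I, ∀ i, s i ≤ t := by
      have : Nonempty I := ⟨⟨p₀, Order.mem_idealOfCofinals _ _⟩⟩
      have : IsDirectedOrder I := ⟨fun x y => by
        obtain ⟨z, hz, hxz, hyz⟩ := I.directed x.1 x.2 y.1 y.2
        exact ⟨⟨z, hz⟩, hxz, hyz⟩⟩
      obtain ⟨t, ht⟩ := Finite.exists_le fun i => (⟨s i, hs i⟩ : I)
      exact ⟨t.1, t.2, ht⟩
    exact t.2.2.comp fun i => ⟨(c i, d i), hst i (hcs i)⟩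
  choose f s hsI hfs using hM
  choose g t htI hgt using hN
  have hinj : ∀ x x' y y', (∃ s ∈ I, (x, y) ∈ s.1) → (∃ s ∈ I, (x', y') ∈ s.1) →
      (x = x' ↔ y = y') := by
    intro x x' y y' h1 h2
    have := hall 2 ![x, x'] ![y, y'] (by
      intro i
      fin_cases i
      · exact h1
      · exact h2) (Term.equal (Term.var 0) (Term.var 1))
    simpa using this
  refine ⟨⟨⟨f, g, fun x => ?_, fun y => ?_⟩, fun F => isEmptyElim F, fun {k} R c => ?_⟩, ?_⟩
  · exact (hinj _ _ _ _ ⟨_, htI (f x), hgt (f x)⟩ ⟨_, hsI x, hfs x⟩).2 rfl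
  · exact (hinj _ _ _ _ ⟨_, hsI (g y), hfs (g y)⟩ ⟨_, htI y, hgt y⟩).1 rfl
  · have := hall k c (f ∘ c) (fun i => ⟨_, hsI _, hfs _⟩) (R.formula fun i => Term.var i)
    simpa only [Formula.realize_rel, Term.realize_var] using this.symm
  · funext i
    refine (hinj (a i) (a i) _ _ ⟨_, hsI _, hfs _⟩ ⟨p₀, Order.mem_idealOfCofinals _ _, ?_⟩).1 rfl
    exact ⟨i, rfl⟩

theorem HasFinitelyManyTypes.nonempty_equiv [L.IsRelational] [Countable M] [Countable N]
    (h : HasFinitelyManyTypes L M) (hMN : L.ElementarilyEquivalent M N) : Nonempty (M ≃[L] N) := by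
  have hab : SameType L (default : Fin 0 → M) (default : Fin 0 → N) := by
    intro φ
    have h1 := elementarilyEquivalent_iff.1 hMN (closeFormula φ)
    rw [realize_closeFormula, realize_closeFormula] at h1
    simpa [Unique.forall_iff] using h1
  exact ⟨(SameType.exists_equiv h hMN hab).choose⟩

theorem HasFinitelyManyTypes.isOligomorphic [L.IsRelational] [Countable M]
    (h : HasFinitelyManyTypes L M) : IsOligomorphic L M := by
  intro n
  obtain ⟨Ψ, hfin, hi, hc⟩ := h n
  have := hfin.to_subtype
  by_cases hne : IsEmpty (Fin n → M)
  · exact ⟨∅, Set.finite_empty, fun b => hne.elim b⟩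
  rw [not_isEmpty_iff] at hne
  have hch : ∀ ψ : Ψ, ∃ a : Fin n → M, (∃ b : Fin n → M, ψ.1.Realize b) → ψ.1.Realize a := by
    intro ψ
    by_cases hψ : ∃ b : Fin n → M, ψ.1.Realize b
    · exact ⟨hψ.choose, fun _ => hψ.choose_spec⟩
    · exact ⟨hne.some, fun h => absurd h hψ⟩
  choose a ha using hch
  refine ⟨Set.range a, Set.finite_range a, fun b => ?_⟩
  obtain ⟨ψ, hψ, hb⟩ := hc b
  exact ⟨_, ⟨⟨ψ, hψ⟩, rfl⟩,
    SameType.exists_equiv h rfl (hi ψ hψ _ _ (ha ⟨ψ, hψ⟩ ⟨b, hb⟩) hb)⟩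

theorem IsOligomorphic.hasFinitelyManyTypes (h : IsOligomorphic L M) :
    HasFinitelyManyTypes L M := by
  intro n
  obtain ⟨A, hA, hAc⟩ := h n
  have := hA.to_subtype
  have hsep : ∀ a b : Fin n → M, ∃ φ : L.Formula (Fin n), φ.Realize a ∧
      (φ.Realize b → SameType L a b) := by
    intro a b
    by_cases hab : SameType L a b
    · exact ⟨⊤, Formula.realize_top.2 trivial, fun _ => hab⟩
    · simp only [SameType, not_forall] at hab
      obtain ⟨φ, hφ⟩ := hab
      by_cases hφa : φ.Realize a
      · exact ⟨φ, hφa, fun hb => absurd (by simp [hφa, hb]) hφ⟩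
      · refine ⟨φ.not, Formula.realize_not.2 hφa, fun hb => absurd ?_ hφ⟩
        rw [Formula.realize_not] at hb
        simp [hφa, hb]
  choose φ hφa hφb using hsep
  let ψ : (Fin n → M) → L.Formula (Fin n) := fun a => Formula.iInf fun b : A => φ a b.1
  have hψ : ∀ a b : Fin n → M, (ψ a).Realize b → SameType L a b := by
    intro a b hb
    obtain ⟨c, hc, g, rfl⟩ := hAc b
    have h1 := Formula.realize_iInf.1 hb ⟨c, hc⟩
    have h2 := hφb a c ((sameType_of_equiv g c _).2 h1)
    exact fun χ => (h2 χ).trans (sameType_of_equiv g c χ)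
  refine ⟨ψ '' A, hA.image _, ?_, fun b => ?_⟩
  · rintro _ ⟨a, -, rfl⟩ b c hb hc
    exact fun χ => (hψ a b hb χ).symm.trans (hψ a c hc χ)
  · obtain ⟨a, ha, g, rfl⟩ := hAc b
    refine ⟨ψ a, ⟨a, ha, rfl⟩, (sameType_of_equiv g a _).1 ?_⟩
    exact Formula.realize_iInf.2 fun b => hφa _ _

end BackAndForth

section RyllNardzewski

/-- Every countably infinite structure elementarily equivalent to `M` is isomorphic to `M`. -/
def IsCountablyCategorical (L : FirstOrder.Language.{u, v}) (M : Type) [L.Structure M] : Prop :=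
  ∀ (N : Type) [L.Structure N] [Countable N] [Infinite N], L.ElementarilyEquivalent M N →
    Nonempty (M ≃[L] N)

variable {L : FirstOrder.Language.{0, 0}} {M : Type} [L.Structure M]

theorem IsCountablyCategorical.exists_realize [Infinite M] [Countable L.Symbols]
    (hM : IsCountablyCategorical L M) {ι : Type} [Countable ι] (Γ : Set (L.Formula ι))
    (hΓ : ∀ Δ : Finset (L.Formula ι), (Δ : Set (L.Formula ι)) ⊆ Γ →
      ∃ v : ι → M, ∀ φ ∈ Δ, φ.Realize v) :
    ∃ v : ι → M, ∀ φ ∈ Γ, φ.Realize v := by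
  classical
  let T' : L[[ι]].Theory :=
    (L.lhomWithConstants ι).onTheory (L.completeTheory M) ∪ Formula.equivSentence '' Γ
  have hsat : T'.IsSatisfiable := by
    rw [Theory.isSatisfiable_iff_isFinitelySatisfiable]
    intro T₀ hT₀
    obtain ⟨v, hv⟩ := hΓ ((T₀.image Formula.equivSentence.symm).filter (· ∈ Γ))
      (fun φ hφ => (Finset.mem_filter.1 hφ).2)
    let : (constantsOn ι).Structure M := constantsOn.structure v
    have h1 : M ⊨ (L.lhomWithConstants ι).onTheory (L.completeTheory M) :=
      (LHom.onTheory_model _ _).2 inferInstance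
    have h2 : M ⊨ (T₀ : L[[ι]].Theory) := by
      refine ⟨fun φ hφ => ?_⟩
      rcases hT₀ hφ with h | ⟨ψ, hψ, rfl⟩
      · exact h1.realize_of_mem φ h
      · refine (Formula.realize_equivSentence M ψ).2 (hv ψ ?_)
        simp only [Finset.mem_filter, Finset.mem_image]
        exact ⟨⟨_, hφ, by simp⟩, hψ⟩
    exact Theory.Model.isSatisfiable M
  obtain ⟨N₀⟩ := hsat
  have hequiv : ∀ N : T'.ModelType, @ElementarilyEquivalent L M N _
      ((L.lhomWithConstants ι).reduct N) := by
    intro N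
    let := (L.lhomWithConstants ι).reduct N
    have h1 : N ⊨ (L.lhomWithConstants ι).onTheory (L.completeTheory M) :=
      N.is_model.mono Set.subset_union_left
    have h2 : N ⊨ L.completeTheory M := (LHom.onTheory_model _ _).1 h1
    exact elementarilyEquivalent_iff.2 fun φ => (realize_iff_of_model_completeTheory M N φ).symm
  have hN₀ : Infinite N₀ := @ElementarilyEquivalent.infinite L M N₀ _
    ((L.lhomWithConstants ι).reduct N₀) _ (hequiv N₀)
  obtain ⟨N, hN⟩ := Theory.exists_model_card_eq ⟨N₀, hN₀⟩ (ℵ₀ : Cardinal.{0}) le_rfl (by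
    rw [lift_le]
    exact mk_le_aleph0_iff.2 inferInstance)
  let := (L.lhomWithConstants ι).reduct N
  have h3 := hequiv N
  have : Infinite N := h3.infinite
  have : Countable N := mk_le_aleph0_iff.1 hN.le
  obtain ⟨g⟩ := hM N h3
  refine ⟨fun i => g.symm (L.con i : N), fun φ hφ => ?_⟩
  have h4 : N ⊨ Formula.equivSentence φ :=
    N.is_model.realize_of_mem _ (Or.inr ⟨φ, hφ, rfl⟩)
  rw [Formula.realize_equivSentence] at h4
  exact (sameType_of_equiv g.symm _ φ).1 h4

theorem IsCountablyCategorical.exists_generic [Infinite M] [Countable L.Symbols]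
    (hM : IsCountablyCategorical L M) {κ : Type} [Countable κ] (D : κ → Set (L.Formula ℕ))
    (hD : ∀ (k : κ) (θ : L.Formula ℕ), (∃ v : ℕ → M, θ.Realize v) →
      ∃ φ ∈ D k, ∃ v : ℕ → M, (θ ⊓ φ).Realize v) :
    ∃ v : ℕ → M, ∀ k, ∃ φ ∈ D k, φ.Realize v := by
  rcases isEmpty_or_nonempty κ with hκ | hκ
  · exact ⟨fun _ => Classical.arbitrary M, fun k => hκ.elim k⟩
  obtain ⟨e, he⟩ := exists_surjective_nat κ
  choose! F hFD hFs using hD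
  let θ : ℕ → L.Formula ℕ := fun n => Nat.rec ⊤ (fun k θ => θ ⊓ F (e k) θ) n
  have hθs : ∀ n, θ (n + 1) = θ n ⊓ F (e n) (θ n) := fun n => rfl
  have hθ : ∀ n, ∃ v : ℕ → M, (θ n).Realize v := by
    intro n
    induction n with
    | zero => exact ⟨fun _ => Classical.arbitrary M, Formula.realize_top.2 trivial⟩
    | succ n ih => exact hFs _ _ ih
  have hmono : ∀ (v : ℕ → M) (m n : ℕ), m ≤ n → (θ n).Realize v → (θ m).Realize v := by
    intro v m n hmn
    induction hmn with
    | refl => exact id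
    | step _ ih =>
      intro h
      rw [hθs, Formula.realize_inf] at h
      exact ih h.1
  obtain ⟨v, hv⟩ := hM.exists_realize (Set.range fun n => θ n) (by
    classical
    intro Δ hΔ
    rw [← Set.image_univ, Finset.subset_set_image_iff] at hΔ
    obtain ⟨s, -, rfl⟩ := hΔ
    obtain ⟨v, hv⟩ := hθ (s.sup id)
    refine ⟨v, fun φ hφ => ?_⟩
    obtain ⟨n, hn, rfl⟩ := Finset.mem_image.1 hφ
    exact hmono v n _ (Finset.le_sup (f := id) hn) hv)
  refine ⟨v, fun k => ?_⟩
  obtain ⟨n, rfl⟩ := he k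
  refine ⟨_, hFD (e n) (θ n) (hθ n), ?_⟩
  have := hv _ ⟨n + 1, rfl⟩
  exact (Formula.realize_inf.1 this).2

theorem realize_congr_freeVar {α : Type*} [DecidableEq α] (φ : L.Formula α) {v v' : α → M}
    (h : ∀ a ∈ φ.freeVarFinset, v a = v' a) : φ.Realize v ↔ φ.Realize v' := by
  unfold Formula.Realize
  rw [← BoundedFormula.realize_restrictFreeVar (f := Subtype.val) (v := v) v fun a => rfl,
    BoundedFormula.realize_restrictFreeVar (f := Subtype.val) (v := v) v' fun a => h a a.2]

theorem exists_witness_dense (φ : L.Formula (ℕ ⊕ Unit)) (θ : L.Formula ℕ)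
    (hθ : ∃ v : ℕ → M, θ.Realize v) :
    ∃ χ ∈ insert (φ.iExs Unit).not
      (Set.range fun j : ℕ => φ.relabel (Sum.elim id fun _ => j)),
      ∃ v : ℕ → M, (θ ⊓ χ).Realize v := by
  classical
  obtain ⟨v, hv⟩ := hθ
  by_cases hx : (φ.iExs Unit).Realize v
  · obtain ⟨x, hx⟩ := Formula.realize_iExs.1 hx
    obtain ⟨j, hj⟩ := Infinite.exists_notMem_finset
      (θ.freeVarFinset ∪ φ.freeVarFinset.preimage Sum.inl Sum.inl_injective.injOn)
    rw [Finset.mem_union, Finset.mem_preimage, not_or] at hj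
    refine ⟨_, Or.inr ⟨j, rfl⟩, Function.update v j (x ()), ?_⟩
    rw [Formula.realize_inf, Formula.realize_relabel]
    constructor
    · refine (realize_congr_freeVar θ fun k hk => ?_).1 hv
      rw [Function.update_of_ne]
      rintro rfl
      exact hj.1 hk
    · refine (realize_congr_freeVar φ ?_).1 hx
      rintro (k | k) hk
      · have : k ≠ j := by
          rintro rfl
          exact hj.2 hk
        simp [Function.update_of_ne this]
      · simp
  · refine ⟨_, Or.inl rfl, v, ?_⟩
    rw [Formula.realize_inf, Formula.realize_not]
    exact ⟨hv, hx⟩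

theorem exists_omit_dense [Nonempty M] {n : ℕ} {a : Fin n → M}
    (ha : ∀ ψ : L.Formula (Fin n), ψ.Realize a → ¬ IsolatesType M ψ) (f : Fin n → ℕ)
    (θ : L.Formula ℕ) (hθ : ∃ v : ℕ → M, θ.Realize v) :
    ∃ χ ∈ {χ | ∃ ψ : L.Formula (Fin n), ψ.Realize a ∧ χ = (ψ.relabel f).not},
      ∃ v : ℕ → M, (θ ⊓ χ).Realize v := by
  classical
  by_contra hcon
  have hall : ∀ v : ℕ → M, θ.Realize v → SameType L a (v ∘ f) := by
    have key : ∀ v : ℕ → M, θ.Realize v → ∀ ψ : L.Formula (Fin n), ψ.Realize a →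
        ψ.Realize (v ∘ f) := by
      intro v hv ψ hψ
      by_contra hn
      refine hcon ⟨_, ⟨ψ, hψ, rfl⟩, v, ?_⟩
      rw [Formula.realize_inf, Formula.realize_not, Formula.realize_relabel]
      exact ⟨hv, hn⟩
    refine fun v hv ψ => ⟨key v hv ψ, fun h => ?_⟩
    by_contra hn
    exact Formula.realize_not.1 (key v hv ψ.not (Formula.realize_not.2 hn)) h
  let S : Finset ℕ := θ.freeVarFinset ∪ Finset.univ.image f
  have hfS : ∀ i, f i ∈ S := fun i =>
    Finset.mem_union_right _ (Finset.mem_image_of_mem _ (Finset.mem_univ i))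
  let θ' : L.Formula S := BoundedFormula.restrictFreeVar θ
    fun k => ⟨k.1, Finset.mem_union_left _ k.2⟩
  have hθ' : ∀ (z : S → M) (v : ℕ → M), (∀ k : S, z k = v k) → (θ'.Realize z ↔ θ.Realize v) :=
    fun z v h => BoundedFormula.realize_restrictFreeVar v fun k => h _
  let ψ : L.Formula (Fin n) := Formula.iExs S ((θ'.relabel Sum.inr) ⊓
    Formula.iInf fun i : Fin n =>
      Term.equal (Term.var (Sum.inr ⟨f i, hfS i⟩)) (Term.var (Sum.inl i)))
  have hψ : ∀ y : Fin n → M, ψ.Realize y ↔ ∃ v : ℕ → M, θ.Realize v ∧ v ∘ f = y := by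
    intro y
    simp only [ψ, Formula.realize_iExs, Formula.realize_inf, Formula.realize_relabel,
      Formula.realize_iInf, Formula.realize_equal, Term.realize_var, Sum.elim_inr, Sum.elim_inl,
      Sum.elim_comp_inr]
    constructor
    · rintro ⟨z, hz, hzy⟩
      refine ⟨fun k => if hk : k ∈ S then z ⟨k, hk⟩ else Classical.arbitrary M,
        (hθ' z _ fun k => by simp).1 hz, ?_⟩
      funext i
      simp [hfS, hzy]
    · rintro ⟨v, hv, rfl⟩
      exact ⟨fun k => v k, (hθ' _ v fun k => rfl).2 hv, fun i => rfl⟩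
  obtain ⟨v, hv⟩ := hθ
  refine ha ψ ((hall v hv ψ).2 ((hψ _).2 ⟨v, hv, rfl⟩)) ?_
  intro b c hb hc
  obtain ⟨v₁, hv₁, rfl⟩ := (hψ b).1 hb
  obtain ⟨v₂, hv₂, rfl⟩ := (hψ c).1 hc
  exact fun χ => (hall v₁ hv₁ χ).symm.trans (hall v₂ hv₂ χ)

theorem IsCountablyCategorical.exists_isolatesType [L.IsRelational] [Infinite M]
    [Countable L.Symbols] (hM : IsCountablyCategorical L M) {n : ℕ} (a : Fin n → M) :
    ∃ ψ : L.Formula (Fin n), ψ.Realize a ∧ IsolatesType M ψ := by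
  by_contra! ha
  obtain ⟨v, hv⟩ := hM.exists_generic (κ := L.Formula (ℕ ⊕ Unit) ⊕ (Fin n → ℕ))
    (Sum.elim (fun φ => insert (φ.iExs Unit).not
        (Set.range fun j : ℕ => φ.relabel (Sum.elim id fun _ => j)))
      fun f => {χ | ∃ ψ : L.Formula (Fin n), ψ.Realize a ∧ χ = (ψ.relabel f).not}) (by
    rintro (φ | f) θ hθ
    · exact exists_witness_dense φ θ hθ
    · exact exists_omit_dense ha f θ hθ)
  let S : L.Substructure M := ⟨Set.range v, fun F => isEmptyElim F⟩
  have hS : S.IsElementary := S.isElementary_of_exists (by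
    intro k φ x y hy
    have hx : ∀ i, ∃ j, v j = x i := fun i => (x i).2
    choose j hj using hx
    let e : Empty ⊕ Fin (k + 1) → ℕ ⊕ Unit :=
      Sum.elim Empty.elim (Fin.snoc (α := fun _ => ℕ ⊕ Unit) (fun i => Sum.inl (j i)) (Sum.inr ()))
    have hφ : ∀ z : M, (φ.toFormula.relabel e).Realize (Sum.elim v fun _ => z) ↔
        φ.Realize default (Fin.snoc ((↑) ∘ x) z : _ → M) := by
      intro z
      rw [Formula.realize_relabel, BoundedFormula.realize_toFormula]
      have : ((Sum.elim v fun _ => z) ∘ e) ∘ Sum.inr = (Fin.snoc ((↑) ∘ x) z : _ → M) := by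
        funext i
        refine Fin.lastCases ?_ (fun i => ?_) i
        · simp [e]
        · simp [e, hj]
      rw [this, Subsingleton.elim (((Sum.elim v fun _ => z) ∘ e) ∘ Sum.inl) default]
    obtain ⟨χ, (rfl | ⟨l, rfl⟩), hχ⟩ := hv (Sum.inl (φ.toFormula.relabel e))
    · rw [Formula.realize_not] at hχ
      exact absurd (Formula.realize_iExs.2 ⟨fun _ => y, (hφ y).2 hy⟩) hχ
    · refine ⟨⟨v l, l, rfl⟩, (hφ _).1 ?_⟩
      rw [Formula.realize_relabel] at hχ
      convert hχ using 1
      funext i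
      rcases i with i | i <;> rfl)
  let S' : L.ElementarySubstructure M := ⟨S, hS⟩
  have hcount : Countable S' := (Set.countable_range v).to_subtype
  have hMS : L.ElementarilyEquivalent M S' := S'.elementarilyEquivalent.symm
  have := hMS.infinite
  obtain ⟨g⟩ := hM S' hMS
  have hga : ∀ i, ∃ j, v j = g (a i) := fun i => (g (a i)).2
  choose f hf using hga
  obtain ⟨_, ⟨ψ, hψ, rfl⟩, hn⟩ := hv (Sum.inr f)
  rw [Formula.realize_not, Formula.realize_relabel] at hn
  refine hn ?_
  have h1 := (sameType_of_equiv g a ψ).1 hψ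
  have h2 := (S'.subtype.map_formula ψ (g ∘ a)).2 h1
  convert h2 using 1
  funext i
  exact hf i

/-- One direction of the Ryll-Nardzewski theorem. -/
theorem IsCountablyCategorical.hasFinitelyManyTypes [L.IsRelational] [Infinite M]
    [Countable L.Symbols] (hM : IsCountablyCategorical L M) : HasFinitelyManyTypes L M := by
  classical
  intro n
  by_contra hn
  obtain ⟨a, ha⟩ := hM.exists_realize
    (Formula.not '' {ψ : L.Formula (Fin n) | IsolatesType M ψ}) (by
      intro Δ hΔ
      obtain ⟨s, hs, rfl⟩ := Finset.subset_set_image_iff.1 hΔ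
      by_contra! hcon
      refine hn ⟨s, s.finite_toSet, fun ψ hψ => hs hψ, fun a => ?_⟩
      obtain ⟨φ, hφ, hφa⟩ := hcon a
      obtain ⟨ψ, hψ, rfl⟩ := Finset.mem_image.1 hφ
      refine ⟨ψ, hψ, ?_⟩
      rwa [Formula.realize_not, not_not] at hφa)
  obtain ⟨ψ, hψ, hi⟩ := hM.exists_isolatesType a
  exact Formula.realize_not.1 (ha _ ⟨ψ, hi, rfl⟩) hψ

end RyllNardzewski

section InterpretedLanguage

variable (L : FirstOrder.Language.{u, v}) (M : Type) [L.Structure M]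

/-- The language having one symbol for every relation on `M` that interprets a symbol of `L`. -/
def interpretedLanguage : FirstOrder.Language.{0, 0} :=
  ⟨fun _ => Empty, fun m => Set.range fun R : L.Relations m => {a : Fin m → M | RelMap R a}⟩

instance : (interpretedLanguage L M).IsRelational := fun _ => inferInstanceAs (IsEmpty Empty)

instance : (interpretedLanguage L M).Structure M where
  funMap f := isEmptyElim f
  RelMap R a := a ∈ R.1

theorem countable_interpretedLanguage {L : FirstOrder.Language.{u, v}} {M : Type} [L.Structure M]
    {r : M → M → Prop} (h : OrderCompatible L r r) :
    Countable (interpretedLanguage L M).Symbols := by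
  have h1 : ∀ m, Countable ((interpretedLanguage L M).Relations m) := by
    intro m
    let F : (interpretedLanguage L M).Relations m → Set (Fin m × Fin m → Prop) :=
      fun R => {P | ∃ a ∈ R.1, P = fun p => r (a p.1) (a p.2)}
    have hF : F.Injective := by
      have key : ∀ R R' : (interpretedLanguage L M).Relations m, F R = F R' → R.1 ⊆ R'.1 := by
        rintro R ⟨_, R', rfl⟩ hRR a ha
        have h2 : (fun p : Fin m × Fin m => r (a p.1) (a p.2)) ∈ F R := ⟨a, ha, rfl⟩
        rw [hRR] at h2
        obtain ⟨b, hb, hab⟩ := h2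
        exact (h R' a b fun i j => iff_of_eq (congrFun hab (i, j))).2 hb
      intro R R' hRR
      exact Subtype.ext ((key R R' hRR).antisymm (key R' R hRR.symm))
    exact (Finite.of_injective F hF).to_countable
  have h2 : ∀ m, Countable ((interpretedLanguage L M).Functions m) := fun m =>
    inferInstanceAs (Countable Empty)
  exact inferInstanceAs (Countable ((Σ m, (interpretedLanguage L M).Functions m) ⊕
    Σ m, (interpretedLanguage L M).Relations m))

variable [L.IsRelational]

/-- The map sending a symbol to its interpretation. -/
def toInterpretedLanguage : L →ᴸ interpretedLanguage L M where
  onFunction _ f := isEmptyElim f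
  onRelation _ R := ⟨{a | RelMap R a}, R, rfl⟩

instance : (toInterpretedLanguage L M).IsExpansionOn M where
  map_onFunction f := isEmptyElim f
  map_onRelation _ _ := rfl

variable {L M}

/-- Isomorphisms of reducts to `L` are isomorphisms in the interpreted language. -/
def interpretedEquiv {N : Type} [L.Structure N] [(interpretedLanguage L M).Structure N]
    [(toInterpretedLanguage L M).IsExpansionOn N] (g : M ≃[L] N) :
    M ≃[interpretedLanguage L M] N where
  toEquiv := g.toEquiv
  map_fun' f := isEmptyElim f
  map_rel' := by
    rintro m ⟨_, R, rfl⟩ a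
    have h1 := LHom.map_onRelation (toInterpretedLanguage L M) R (M := N) (g ∘ a)
    have h2 := LHom.map_onRelation (toInterpretedLanguage L M) R (M := M) a
    exact (iff_of_eq h1).trans ((g.map_rel R a).trans (iff_of_eq h2).symm)

theorem IsCountablyCategorical.isOligomorphic_of_orderCompatible [Countable M] [Infinite M]
    (hM : IsCountablyCategorical L M) {r : M → M → Prop} (h : OrderCompatible L r r) :
    IsOligomorphic L M := by
  have hcat : IsCountablyCategorical (interpretedLanguage L M) M := by
    intro N _ _ _ hN
    let := (toInterpretedLanguage L M).reduct N
    have h1 : L.ElementarilyEquivalent M N := elementarilyEquivalent_iff.2 fun φ => by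
      rw [← LHom.realize_onSentence M (toInterpretedLanguage L M),
        ← LHom.realize_onSentence N (toInterpretedLanguage L M)]
      exact elementarilyEquivalent_iff.1 hN _
    obtain ⟨g⟩ := hM N h1
    exact ⟨interpretedEquiv g⟩
  have := countable_interpretedLanguage h
  intro n
  obtain ⟨A, hA, hc⟩ := hcat.hasFinitelyManyTypes.isOligomorphic n
  refine ⟨A, hA, fun b => ?_⟩
  obtain ⟨a, ha, g, hg⟩ := hc b
  refine ⟨a, ha, ⟨g.toEquiv, fun f => isEmptyElim f, fun R x => ?_⟩, hg⟩
  exact g.map_rel ((toInterpretedLanguage L M).onRelation R) x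

end InterpretedLanguage

section Transfer

variable {L : FirstOrder.Language.{u, v}} {M : Type w} [L.Structure M] (lo : LinearOrder M)

/-- Automorphisms of an order chaining `M` are automorphisms of `M`. -/
theorem Chains.isOligomorphic [L.IsRelational] (h : Chains L lo)
    (ho : @IsOligomorphic Language.order M (ltStructure lo)) : IsOligomorphic L M := by
  let := ltStructure lo
  intro n
  obtain ⟨A, hA, hc⟩ := ho n
  refine ⟨A, hA, fun b => ?_⟩
  obtain ⟨a, ha, g, hg⟩ := hc b
  refine ⟨a, ha, ⟨g.toEquiv, fun f => isEmptyElim f, fun {m} R x => ?_⟩, hg⟩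
  obtain ⟨φ, -, hφ⟩ := h m R
  exact (hφ _).trans ((sameType_of_equiv g x φ).symm.trans (hφ x).symm)

/-- An order preserving permutation is an automorphism of the order structure. -/
def ltStructureEquiv {N : Type w'} (lo' : LinearOrder N) (e : M ≃ N)
    (he : ∀ x y, lo'.lt (e x) (e y) ↔ lo.lt x y) :
    @Language.Equiv Language.order M N (ltStructure lo) (ltStructure lo') :=
  letI := ltStructure lo
  letI := ltStructure lo'
  { toEquiv := e
    map_fun' := fun f => isEmptyElim f
    map_rel' := fun {n} R x => by
      match n, R with
      | 2, .le => exact he _ _ }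

theorem IsOligomorphic.ltStructure (h : IsOligomorphic L M) (C : Finset M)
    (hC : ∀ g : M ≃[L] M, (∀ c ∈ C, g c = c) → ∀ x y, lo.lt x y → lo.lt (g x) (g y)) :
    @IsOligomorphic Language.order M (ltStructure lo) := by
  classical
  let := _root_.ltStructure lo
  intro n
  have hC' : ∀ g : M ≃[L] M, (∀ c ∈ C, g c = c) → ∀ x y, lo.lt (g x) (g y) ↔ lo.lt x y := by
    intro g hg x y
    refine ⟨fun hxy => ?_, hC g hg x y⟩
    have := hC g.symm (fun c hc => by
      have := congrArg g.symm (hg c hc)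
      rw [g.symm_apply_apply] at this
      exact this.symm) _ _ hxy
    rwa [g.symm_apply_apply, g.symm_apply_apply] at this
  let c : Fin C.card → M := fun i => (C.equivFin.symm i).1
  have hc : ∀ x ∈ C, ∃ i, c i = x := fun x hx => ⟨C.equivFin ⟨x, hx⟩, by simp [c]⟩
  obtain ⟨A, hA, hAc⟩ := h (n + C.card)
  let Q : (Fin (n + C.card) → M) → (Fin n → M) → Prop :=
    fun a b => ∃ g : M ≃[L] M, g ∘ a = Fin.append b c
  by_cases hne : IsEmpty (Fin n → M)
  · exact ⟨∅, Set.finite_empty, fun b => hne.elim b⟩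
  rw [not_isEmpty_iff] at hne
  have hF : ∀ a, ∃ b, (∃ b', Q a b') → Q a b := fun a => by
    by_cases hQ : ∃ b', Q a b'
    · exact ⟨hQ.choose, fun _ => hQ.choose_spec⟩
    · exact ⟨hne.some, fun h => absurd h hQ⟩
  choose F hF using hF
  refine ⟨F '' A, hA.image F, fun b => ?_⟩
  obtain ⟨a, ha, g, hg⟩ := hAc (Fin.append b c)
  obtain ⟨g', hg'⟩ := hF a ⟨b, g, hg⟩
  have hap : ∀ i, g (g'.symm (Fin.append (F a) c i)) = Fin.append b c i := by
    intro i
    rw [← congrFun hg' i, Function.comp_apply, g'.symm_apply_apply]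
    exact congrFun hg i
  have hfix : ∀ x ∈ C, (g.comp g'.symm) x = x := by
    intro x hx
    obtain ⟨i, rfl⟩ := hc x hx
    simpa using hap (Fin.natAdd n i)
  refine ⟨F a, ⟨a, ha, rfl⟩, ltStructureEquiv lo lo (g.comp g'.symm).toEquiv (hC' _ hfix), ?_⟩
  funext i
  have := hap (Fin.castAdd _ i)
  rw [Fin.append_left, Fin.append_left] at this
  exact this

end Transfer

section DenseOrders

theorem realize_of_elementarilyEquivalent {L : FirstOrder.Language.{u, v}} {M : Type w}
    {N : Type w'} [L.Structure M] [L.Structure N] (h : L.ElementarilyEquivalent M N) {n : ℕ}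
    (φ : L.Formula (Fin n)) (hφ : ∀ v : Fin n → M, φ.Realize v) (v : Fin n → N) : φ.Realize v := by
  have h1 := elementarilyEquivalent_iff.1 h (closeFormula φ)
  rw [realize_closeFormula, realize_closeFormula] at h1
  exact h1.1 hφ v

/-- Countable structures elementarily equivalent to a countable dense order without endpoints are
isomorphic to it. -/
theorem nonempty_equiv_of_dense {M : Type w} {N : Type w'} (lo : LinearOrder M) [Countable M]
    [Nonempty M] [DenselyOrdered M] [NoMinOrder M] [NoMaxOrder M] [S : Language.order.Structure N]
    [Countable N] [Nonempty N]
    (h : @ElementarilyEquivalent Language.order M N (ltStructure lo) S) :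
    Nonempty (@Language.Equiv Language.order M N (ltStructure lo) S) := by
  classical
  let := ltStructure lo
  let r : N → N → Prop := fun x y => RelMap (L := Language.order) leSymb ![x, y]
  have hr : ∀ {β : Type} (v : β → N) (i j : β), (ltFormula i j).Realize v ↔ r (v i) (v j) := by
    intro β v i j
    simp only [ltFormula, Formula.realize_rel₂, Term.realize_var, r]
  have hM : ∀ {β : Type} (v : β → M) (i j : β), (ltFormula i j).Realize v ↔ v i < v j :=
    fun v i j => realize_ltFormula lo i j v
  have hirr : ∀ x, ¬ r x x := by
    intro x
    have := realize_of_elementarilyEquivalent h (n := 1) (ltFormula 0 0).not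
      (fun v => by simp [hM]) ![x]
    simpa [hr] using this
  have htrans : ∀ x y z, r x y → r y z → r x z := by
    intro x y z
    have := realize_of_elementarilyEquivalent h (n := 3)
      ((ltFormula 0 1).imp ((ltFormula 1 2).imp (ltFormula 0 2)))
      (fun v => by
        simp only [Formula.realize_imp, hM]
        exact lt_trans) ![x, y, z]
    simpa [hr] using this
  have htri : ∀ x y, r x y ∨ x = y ∨ r y x := by
    intro x y
    have := realize_of_elementarilyEquivalent h (n := 2)
      (ltFormula 0 1 ⊔ (Term.equal (Term.var 0) (Term.var 1) ⊔ ltFormula 1 0))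
      (fun v => by
        simp only [Formula.realize_sup, hM, Formula.realize_equal, Term.realize_var]
        exact lt_trichotomy _ _) ![x, y]
    simpa [hr] using this
  have hdense : ∀ x y, r x y → ∃ z, r x z ∧ r z y := by
    intro x y
    have := realize_of_elementarilyEquivalent h (n := 2)
      ((ltFormula 0 1).imp (Formula.iExs Unit
        (ltFormula (Sum.inl 0) (Sum.inr ()) ⊓ ltFormula (Sum.inr ()) (Sum.inl 1))))
      (fun v => by
        simp only [Formula.realize_imp, Formula.realize_iExs, Formula.realize_inf, hM,
          Sum.elim_inl, Sum.elim_inr]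
        intro hxy
        obtain ⟨z, hz⟩ := exists_between hxy
        exact ⟨fun _ => z, hz⟩) ![x, y]
    simp only [Formula.realize_imp, Formula.realize_iExs, Formula.realize_inf, hr,
      Sum.elim_inl, Sum.elim_inr] at this
    exact fun hxy => ⟨_, (this hxy).choose_spec⟩
  have hmax : ∀ x, ∃ z, r x z := by
    intro x
    have := realize_of_elementarilyEquivalent h (n := 1)
      (Formula.iExs Unit (ltFormula (Sum.inl 0) (Sum.inr ())))
      (fun v => by
        simp only [Formula.realize_iExs, hM, Sum.elim_inl, Sum.elim_inr]
        obtain ⟨z, hz⟩ := exists_gt (v 0)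
        exact ⟨fun _ => z, hz⟩) ![x]
    simp only [Formula.realize_iExs, hr, Sum.elim_inl, Sum.elim_inr] at this
    exact ⟨_, this.choose_spec⟩
  have hmin : ∀ x, ∃ z, r z x := by
    intro x
    have := realize_of_elementarilyEquivalent h (n := 1)
      (Formula.iExs Unit (ltFormula (Sum.inr ()) (Sum.inl 0)))
      (fun v => by
        simp only [Formula.realize_iExs, hM, Sum.elim_inl, Sum.elim_inr]
        obtain ⟨z, hz⟩ := exists_lt (v 0)
        exact ⟨fun _ => z, hz⟩) ![x]
    simp only [Formula.realize_iExs, hr, Sum.elim_inl, Sum.elim_inr] at this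
    exact ⟨_, this.choose_spec⟩
  have : IsStrictTotalOrder N r :=
    { irrefl := hirr
      trans := htrans
      trichotomous := fun x y hxy hyx => ((htri x y).resolve_left hxy).resolve_right hyx }
  let lo' : LinearOrder N := linearOrderOfSTO r
  have : DenselyOrdered N := ⟨fun x y hxy => hdense x y hxy⟩
  have : NoMinOrder N := ⟨fun x => hmin x⟩
  have : NoMaxOrder N := ⟨fun x => hmax x⟩
  obtain ⟨e⟩ := Order.iso_of_countable_dense M N
  refine ⟨⟨e.toEquiv, fun f => isEmptyElim f, fun {n} R x => ?_⟩⟩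
  match n, R with
  | 2, .le =>
    have h1 : RelMap (L := Language.order) leSymb (e ∘ x) ↔ r (e (x 0)) (e (x 1)) := by
      have : e ∘ x = ![e (x 0), e (x 1)] := by
        funext i
        fin_cases i <;> rfl
      rw [this]
    exact h1.trans (e.lt_iff_lt (x := x 0) (y := x 1))

/-- There is an order on the natural numbers isomorphic to the rationals. -/
theorem exists_dense_linearOrder : ∃ lo : LinearOrder ℕ,
    @DenselyOrdered ℕ lo.toLT ∧ @NoMinOrder ℕ lo.toLT ∧ @NoMaxOrder ℕ lo.toLT := by
  obtain ⟨e⟩ := nonempty_equiv_of_countable (α := ℕ) (β := ℚ)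
  let lo : LinearOrder ℕ := LinearOrder.lift' e e.injective
  have hlt : ∀ x y : ℕ, lo.lt x y ↔ e x < e y := fun x y => Iff.rfl
  refine ⟨lo, @DenselyOrdered.mk ℕ lo.toLT fun x y hxy => ?_, @NoMinOrder.mk ℕ lo.toLT fun x => ?_,
    @NoMaxOrder.mk ℕ lo.toLT fun x => ?_⟩
  · obtain ⟨z, hz⟩ := exists_between ((hlt x y).1 hxy)
    refine ⟨e.symm z, (hlt _ _).2 ?_, (hlt _ _).2 ?_⟩
    · simpa using hz.1
    · simpa using hz.2
  · obtain ⟨z, hz⟩ := exists_lt (e x)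
    refine ⟨e.symm z, (hlt _ _).2 ?_⟩
    simpa using hz
  · obtain ⟨z, hz⟩ := exists_gt (e x)
    refine ⟨e.symm z, (hlt _ _).2 ?_⟩
    simpa using hz

theorem EqualityDefinable.orderCompatible {L : FirstOrder.Language.{u, v}} {M : Type w}
    [L.Structure M] (h : EqualityDefinable L M) (lo : LinearOrder M) :
    OrderCompatible L lo.lt lo.lt := by
  have key : ∀ x y : M, x = y ↔ ¬ lo.lt x y ∧ ¬ lo.lt y x := by
    intro x y
    constructor
    · rintro rfl
      exact ⟨lt_irrefl _, lt_irrefl _⟩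
    · rintro ⟨h1, h2⟩
      exact le_antisymm (not_lt.1 h2) (not_lt.1 h1)
  intro m R a b hab
  refine h R a b fun i j => ?_
  rw [key, key, hab i j, hab j i]

end DenseOrders

section Categoricity

variable {L : FirstOrder.Language.{u, v}}

theorem categorical_completeTheory (L : FirstOrder.Language.{u, v}) [L.Structure ℕ]
    (h : ∀ (N : Type w) [L.Structure N] [Countable N] [Infinite N],
      L.ElementarilyEquivalent ℕ N → Nonempty (ℕ ≃[L] N)) :
    Cardinal.Categorical (ℵ₀ : Cardinal.{w}) (L.completeTheory ℕ) := by
  have key : ∀ N : (L.completeTheory ℕ).ModelType, #N = (ℵ₀ : Cardinal.{w}) →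
      Nonempty (ℕ ≃[L] N) := by
    intro N hN
    have : Countable N := mk_le_aleph0_iff.1 hN.le
    have : Infinite N := Cardinal.infinite_iff.2 hN.ge
    exact h N (elementarilyEquivalent_iff.2 fun φ => (realize_iff_of_model_completeTheory ℕ N φ).symm)
  intro N N' hN hN'
  obtain ⟨g⟩ := key N hN
  obtain ⟨g'⟩ := key N' hN'
  exact ⟨g'.comp g.symm⟩

theorem isCountablyCategorical_of_categorical [L.Structure ℕ]
    (h : Cardinal.Categorical (ℵ₀ : Cardinal.{w}) (L.completeTheory ℕ)) :
    IsCountablyCategorical L ℕ := by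
  have key : ∀ (N : Type) [L.Structure N] [Countable N] [Infinite N],
      L.ElementarilyEquivalent ℕ N → ∃ N' : (L.completeTheory ℕ).ModelType,
        #N' = (ℵ₀ : Cardinal.{w}) ∧ Nonempty (N ≃[L] N') := by
    intro N _ _ _ hN
    let e : N ≃ ULift.{w} N := Equiv.ulift.symm
    let := e.inducedStructure (L := L)
    have h0 : N ⊨ L.completeTheory ℕ := ⟨fun φ hφ => (elementarilyEquivalent_iff.1 hN φ).1 hφ⟩
    have h1 : ULift.{w} N ⊨ L.completeTheory ℕ :=
      StrongHomClass.theory_model (e.inducedStructureEquiv (L := L))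
    refine ⟨Theory.ModelType.of (L.completeTheory ℕ) (ULift.{w} N), ?_,
      ⟨e.inducedStructureEquiv (L := L)⟩⟩
    exact mk_eq_aleph0 (ULift.{w} N)
  intro N _ _ _ hN
  obtain ⟨M', hM', ⟨g⟩⟩ := key ℕ rfl
  obtain ⟨N', hN', ⟨g'⟩⟩ := key N hN
  obtain ⟨f⟩ := h M' N' hM' hN'
  exact ⟨g'.symm.comp (f.comp g)⟩

theorem numCountableModels_eq_one_iff (T : L.Theory) (hT : T.IsComplete) :
    numCountableModels L T = 1 ↔
      ∃ S : L.Structure ℕ, @Theory.Model L ℕ S T ∧ @IsCountablyCategorical L ℕ S := by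
  have hequiv : Equivalence
      (fun S₁ S₂ : {S : L.Structure ℕ // @Theory.Model L ℕ S T} =>
        Nonempty (@Language.Equiv L ℕ ℕ S₁.1 S₂.1)) :=
    { refl := fun S => ⟨@Language.Equiv.refl L ℕ S.1⟩
      symm := fun {S S'} ⟨g⟩ => ⟨@Language.Equiv.symm L ℕ ℕ S.1 S'.1 g⟩
      trans := fun {S S' S''} ⟨g⟩ ⟨g'⟩ => ⟨@Language.Equiv.comp L ℕ ℕ S.1 S'.1 ℕ S''.1 g' g⟩ }
  unfold numCountableModels CountableModelClasses
  rw [Cardinal.eq_one_iff_unique]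
  constructor
  · rintro ⟨hs, ⟨q⟩⟩
    obtain ⟨S, -⟩ := Quot.exists_rep q
    let := S.1
    have hS := S.2
    refine ⟨S.1, S.2, ?_⟩
    intro N _ _ _ hN
    obtain ⟨e⟩ := nonempty_equiv_of_countable (α := N) (β := ℕ)
    have h0 : N ⊨ T := ⟨fun φ hφ =>
      (elementarilyEquivalent_iff.1 hN φ).1 (hS.realize_of_mem φ hφ)⟩
    let S' : L.Structure ℕ := e.inducedStructure
    let g : @Language.Equiv L N ℕ _ S' := e.inducedStructureEquiv (L := L)
    have h1 : @Theory.Model L ℕ S' T := @StrongHomClass.theory_model L N ℕ _ S' T _ _ _ g _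
    have h2 := hequiv.eqvGen_iff.1
      (Quot.eqvGen_exact (hs.elim (Quot.mk _ S) (Quot.mk _ ⟨S', h1⟩)))
    obtain ⟨f⟩ := h2
    exact ⟨@Language.Equiv.comp L ℕ ℕ S.1 S' N _ (@Language.Equiv.symm L N ℕ _ S' g) f⟩
  · rintro ⟨S, hS, hcat⟩
    have key : ∀ S' : {S : L.Structure ℕ // @Theory.Model L ℕ S T},
        Nonempty (@Language.Equiv L ℕ ℕ S S'.1) := by
      rintro ⟨S', hS'⟩
      refine @hcat ℕ S' _ _ ((@elementarilyEquivalent_iff L ℕ ℕ S S').2 fun φ => ?_)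
      exact (@Theory.IsComplete.realize_sentence_iff L T hT φ ℕ S hS _).trans
        (@Theory.IsComplete.realize_sentence_iff L T hT φ ℕ S' hS' _).symm
    refine ⟨⟨fun q q' => ?_⟩, ⟨Quot.mk _ ⟨S, hS⟩⟩⟩
    induction q using Quot.ind with | _ S₁ => ?_
    induction q' using Quot.ind with | _ S₂ => ?_
    exact Quot.sound (hequiv.trans (hequiv.symm (x := ⟨S, hS⟩) (key S₁)) (key S₂))

theorem exists_orderCompatible_of_isMonomorphicTheory [L.IsRelational] {T : L.Theory}
    (hmono : IsMonomorphicTheory.{u, v, w} L T) [L.Structure ℕ] (hT : ℕ ⊨ T) :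
    ∃ r : ℕ → ℕ → Prop, IsStrictTotalOrder ℕ r ∧ OrderCompatible L r r := by
  let e : ℕ ≃ ULift.{w} ℕ := Equiv.ulift.symm
  let := e.inducedStructure (L := L)
  let g : ℕ ≃[L] ULift.{w} ℕ := e.inducedStructureEquiv
  have h1 : ULift.{w} ℕ ⊨ T := StrongHomClass.theory_model g
  obtain ⟨r, hr, hc⟩ := IsMonomorphic.exists_orderCompatible (hmono _ h1)
  refine ⟨fun x y => r (e x) (e y), ?_, fun m R a b hab => ?_⟩
  · exact (RelEmbedding.preimage e.toEmbedding r).isStrictTotalOrder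
  · exact (g.map_rel R a).symm.trans ((hc R (g ∘ a) (g ∘ b) hab).trans (g.map_rel R b))

theorem IsCountablyCategorical.exists_categorical_order [L.IsRelational] [L.Structure ℕ]
    (h : IsCountablyCategorical L ℕ) {r : ℕ → ℕ → Prop} [IsStrictTotalOrder ℕ r]
    (hr : OrderCompatible L r r) :
    ∃ lo : LinearOrder ℕ, Chains L lo ∧ Cardinal.Categorical (ℵ₀ : Cardinal.{w})
      (@completeTheory Language.order ℕ (ltStructure lo)) := by
  classical
  have hol := h.isOligomorphic_of_orderCompatible hr
  by_cases hL : EqualityDefinable L ℕ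
  · obtain ⟨lo, h1, h2, h3⟩ := exists_dense_linearOrder
    refine ⟨lo, chains_of_orderCompatible lo (EqualityDefinable.orderCompatible hL lo), ?_⟩
    let := ltStructure lo
    refine categorical_completeTheory Language.order ?_
    intro N _ _ _ hN
    exact @nonempty_equiv_of_dense ℕ N lo _ _ h1 h2 h3 _ _ _ hN
  · obtain ⟨s, hs, hsc, C, hC⟩ := exists_order_preserved hr hL
    let lo : LinearOrder ℕ := linearOrderOfSTO s
    refine ⟨lo, chains_of_orderCompatible lo hsc, ?_⟩
    let := ltStructure lo
    refine categorical_completeTheory Language.order ?_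
    intro N _ _ _ hN
    exact (IsOligomorphic.ltStructure lo hol C hC).hasFinitelyManyTypes.nonempty_equiv hN

theorem isCountablyCategorical_of_chains [L.IsRelational] [L.Structure ℕ] (lo : LinearOrder ℕ)
    (hlo : Chains L lo) (h : Cardinal.Categorical (ℵ₀ : Cardinal.{w})
      (@completeTheory Language.order ℕ (ltStructure lo))) : IsCountablyCategorical L ℕ := by
  let := ltStructure lo
  have h1 := (isCountablyCategorical_of_categorical h).hasFinitelyManyTypes.isOligomorphic
  intro N _ _ _ hN
  exact (Chains.isOligomorphic lo hlo h1).hasFinitelyManyTypes.nonempty_equiv hN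

end Categoricity

end MonomorphicTheory

open MonomorphicTheory

/-- If `T` is a complete monomorphic theory in a relational language having infinite models,
then `I(T,ω) = 1` iff some countably infinite model of `T` (one with domain `ℕ`) is chained
by a linear order on its domain whose complete first-order theory is `ℵ₀`-categorical. -/
theorem countably_categorical_iff_chained_by_categorical_order
    (L : FirstOrder.Language.{u, v}) [L.IsRelational] (T : L.Theory)
    (hcomplete : T.IsComplete)
    (hmono : IsMonomorphicTheory.{u, v, w} L T)
    (hinf : ∃ (M : Type w) (_ : L.Structure M), Infinite M ∧ M ⊨ T) :
    numCountableModels L T = 1 ↔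
      ∃ S : L.Structure ℕ, @FirstOrder.Language.Theory.Model L ℕ S T ∧
        ∃ lo : LinearOrder ℕ, @Chains L ℕ S lo ∧
          Cardinal.Categorical Cardinal.aleph0
            (@FirstOrder.Language.completeTheory FirstOrder.Language.order ℕ
              (ltStructure lo)) := by
  rw [numCountableModels_eq_one_iff T hcomplete]
  constructor
  · rintro ⟨S, hS, hcat⟩
    obtain ⟨r, hr, hrc⟩ := exists_orderCompatible_of_isMonomorphicTheory hmono hS
    exact ⟨S, hS, hcat.exists_categorical_order hrc⟩
  · rintro ⟨S, hS, lo, hlo, h⟩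
    exact ⟨S, hS, isCountablyCategorical_of_chains lo hlo h⟩
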